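/- arXiv:1007.1359 — 3 statements merged into one kernel-verified Lean document; each statement's English description precedes it below -/
import Mathlib

section
/- Let s ≥ 0. For every u₀ ∈ H^s(T) there exist a time T > 0 and a unique u ∈ X^s_T = C⁰([−T,T], H^s(T)) solving the BBM integral equation u(t) = e^{−itφ(D)}u₀ − (i/2)∫₀ᵗ e^{−i(t−τ)φ(D)} φ(D)(u(τ)²) dτ. Moreover the maximal existence time T_s satisfies T_s ≥ 1/(4 C_s ‖u₀‖_{H^s}), where C_s is the constant in the bilinear estimate ‖φ(D)(uv)‖_{H^s} ≤ C_s ‖u‖_{H^s}‖v‖_{H^s}. -/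
open scoped BigOperators ComplexConjugate
open Complex

noncomputable section

namespace BBM

/-!  We work on the torus `𝕋 = ℝ/2πℤ` at the level of Fourier coefficients: a function
`u` on `𝕋` is identified with its sequence of Fourier coefficients `û : ℤ → ℂ`
(`u(x) = Σ_k û(k) e^{ikx}`).  The product of two functions corresponds to the convolution
of their Fourier coefficients, and the Sobolev space `H^s(𝕋)` to the weighted `ℓ²` space
with weight `⟨k⟩^{2s} = (1+k²)^s`. -/

/-- Sobolev weight `⟨k⟩^{2s} = (1+k²)^s`. -/
def wt (s : ℝ) (k : ℤ) : ℝ := (1 + (k : ℝ) ^ 2) ^ s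

/-- `u ∈ H^s(𝕋)`: square-summability of the Fourier coefficients against `⟨k⟩^{2s}`. -/
def MemHs (s : ℝ) (u : ℤ → ℂ) : Prop :=
  Summable fun k : ℤ => wt s k * ‖u k‖ ^ 2

/-- The `H^s(𝕋)` norm, `‖u‖_{H^s} = (Σ_k ⟨k⟩^{2s} |û(k)|²)^{1/2}`. -/
def hsNorm (s : ℝ) (u : ℤ → ℂ) : ℝ :=
  Real.sqrt (∑' k : ℤ, wt s k * ‖u k‖ ^ 2)

/-- The symbol `φ(k) = k/(1+k²)` of the Fourier multiplier `φ(D)`. -/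
def phiSymb (k : ℤ) : ℝ := (k : ℝ) / (1 + (k : ℝ) ^ 2)

/-- The Fourier multiplier `φ(D)`, `(φ(D)u)^(k) = φ(k) û(k)`. -/
def phiD (u : ℤ → ℂ) : ℤ → ℂ := fun k => (phiSymb k : ℂ) * u k

/-- Fourier coefficients of the pointwise product `uv`: the convolution `û * v̂`. -/
def prodHat (u v : ℤ → ℂ) : ℤ → ℂ := fun k => ∑' l : ℤ, u l * v (k - l)

/-- Fourier coefficients of the free evolution `e^{-itφ(D)}u`. -/
def freeEvol (t : ℝ) (u : ℤ → ℂ) : ℤ → ℂ :=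
  fun k => Complex.exp (-Complex.I * t * phiSymb k) * u k

/-- `u` is the sequence of Fourier coefficients of a real-valued function. -/
def IsRealSeq (u : ℤ → ℂ) : Prop := ∀ k : ℤ, u (-k) = conj (u k)

/-- The Duhamel (integral) form of the BBM equation at time `t`:
`u(t) = e^{-itφ(D)}u₀ - (i/2) ∫₀ᵗ e^{-i(t-τ)φ(D)} φ(D)(u(τ)²) dτ`, coefficientwise. -/
def SolvesBBM (u₀ : ℤ → ℂ) (u : ℝ → ℤ → ℂ) (t : ℝ) : Prop :=
  ∀ k : ℤ, u t k = freeEvol t u₀ k -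
    (Complex.I / 2) * ∫ τ in (0:ℝ)..t,
      Complex.exp (-Complex.I * (t - τ) * phiSymb k) * (phiSymb k : ℂ) *
        prodHat (u τ) (u τ) k

/-- `u ∈ C⁰([-T,T], H^s(𝕋))`: membership in `H^s` at every time together with continuity
in time with respect to the `H^s` norm. -/
def ContHs (s T : ℝ) (u : ℝ → ℤ → ℂ) : Prop :=
  (∀ t ∈ Set.Icc (-T) T, MemHs s (u t)) ∧
  ∀ t₀ ∈ Set.Icc (-T) T, ∀ ε : ℝ, 0 < ε → ∃ δ : ℝ, 0 < δ ∧
    ∀ t ∈ Set.Icc (-T) T, |t - t₀| < δ →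
      hsNorm s (fun k => u t k - u t₀ k) < ε

/-- `u` is a solution of the BBM equation in `X^s_T = C⁰([-T,T], H^s(𝕋))` with initial
data `u₀`. -/
def IsSolOn (s T : ℝ) (u₀ : ℤ → ℂ) (u : ℝ → ℤ → ℂ) : Prop :=
  ContHs s T u ∧ ∀ t ∈ Set.Icc (-T) T, SolvesBBM u₀ u t


abbrev E2 : Type := lp (fun _ : ℤ => ℂ) 2

def sw (s : ℝ) (k : ℤ) : ℝ := Real.sqrt (wt s k)

lemma wt_pos (s : ℝ) (k : ℤ) : 0 < wt s k := by
  unfold wt; positivity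

lemma sw_pos (s : ℝ) (k : ℤ) : 0 < sw s k := Real.sqrt_pos.2 (wt_pos s k)

lemma sw_ne (s : ℝ) (k : ℤ) : (sw s k : ℂ) ≠ 0 := by
  exact_mod_cast (sw_pos s k).ne'

lemma one_le_sw {s : ℝ} (hs : 0 ≤ s) (k : ℤ) : 1 ≤ sw s k := by
  unfold sw wt
  rw [Real.one_le_sqrt]
  exact Real.one_le_rpow (by nlinarith [sq_nonneg (k : ℝ)]) hs

lemma norm_sw_mul (s : ℝ) (k : ℤ) (z : ℂ) : ‖(sw s k : ℂ) * z‖ ^ (2 : ℝ) = wt s k * ‖z‖ ^ 2 := by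
  rw [norm_mul, Complex.norm_real, Real.norm_of_nonneg (sw_pos s k).le]
  rw [show (2 : ℝ) = ((2 : ℕ) : ℝ) by norm_num, Real.rpow_natCast, mul_pow, sw,
    Real.sq_sqrt (wt_pos s k).le]

lemma enc_mem {s : ℝ} {u : ℤ → ℂ} (h : MemHs s u) :
    Memℓp (fun k => (sw s k : ℂ) * u k) 2 := by
  apply memℓp_gen
  simp only [ENNReal.toReal_ofNat, norm_sw_mul]
  exact h

def enc (s : ℝ) (u : ℤ → ℂ) (h : MemHs s u) : E2 := ⟨fun k => (sw s k : ℂ) * u k, enc_mem h⟩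

def dec (s : ℝ) (f : E2) : ℤ → ℂ := fun k => (sw s k : ℂ)⁻¹ * f k

lemma sw_mul_dec (s : ℝ) (f : E2) (k : ℤ) : (sw s k : ℂ) * dec s f k = f k := by
  unfold dec
  rw [mul_inv_cancel_left₀ (sw_ne s k)]

lemma dec_mem (s : ℝ) (f : E2) : MemHs s (dec s f) := by
  unfold MemHs
  simp only [← norm_sw_mul, sw_mul_dec]
  simpa using (lp.memℓp f).summable (by norm_num)

lemma dec_enc {s : ℝ} {u : ℤ → ℂ} (h : MemHs s u) : dec s (enc s u h) = u := by
  funext k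
  simp only [dec, enc]
  rw [inv_mul_cancel_left₀ (sw_ne s k)]

lemma dec_inj {s : ℝ} {f g : E2} (h : dec s f = dec s g) : f = g := by
  ext k
  rw [← sw_mul_dec s f, ← sw_mul_dec s g, h]

lemma hsNorm_dec (s : ℝ) (f : E2) : hsNorm s (dec s f) = ‖f‖ := by
  unfold hsNorm
  simp only [← norm_sw_mul, sw_mul_dec]
  have := lp.norm_rpow_eq_tsum (p := 2) (by norm_num) f
  simp only [ENNReal.toReal_ofNat] at this
  rw [← this, show (2 : ℝ) = ((2 : ℕ) : ℝ) by norm_num, Real.rpow_natCast,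
    Real.sqrt_sq (norm_nonneg _)]

lemma norm_enc {s : ℝ} {u : ℤ → ℂ} (h : MemHs s u) : ‖enc s u h‖ = hsNorm s u := by
  rw [← hsNorm_dec s, dec_enc]

lemma dec_add (s : ℝ) (f g : E2) : dec s (f + g) = dec s f + dec s g := by
  funext k; simp [dec, mul_add]

lemma dec_sub (s : ℝ) (f g : E2) : dec s (f - g) = dec s f - dec s g := by
  funext k; simp [dec, mul_sub]

lemma dec_smul (s : ℝ) (c : ℂ) (f : E2) : dec s (c • f) = c • dec s f := by
  funext k; simp [dec]; ring

lemma dec_sq_summable {s : ℝ} (hs : 0 ≤ s) (f : E2) : Summable fun k => ‖dec s f k‖ ^ 2 := by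
  refine Summable.of_nonneg_of_le (fun k => by positivity) (fun k => ?_) (dec_mem s f)
  have h1 : 1 ≤ wt s k := by
    have := one_le_sw hs k
    rwa [sw, Real.one_le_sqrt] at this
  nlinarith [sq_nonneg ‖dec s f k‖]

lemma conv_summable {s : ℝ} (hs : 0 ≤ s) (f g : E2) (k : ℤ) :
    Summable fun l => dec s f l * dec s g (k - l) := by
  have h1 := dec_sq_summable hs f
  have h2 : Summable fun l => ‖dec s g (k - l)‖ ^ 2 :=
    (dec_sq_summable hs g).comp_injective (i := fun l => k - l) (fun a b h => by simpa using h)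
  refine Summable.of_norm_bounded (h1.add h2) (fun l => ?_)
  rw [norm_mul]
  nlinarith [sq_nonneg (‖dec s f l‖ - ‖dec s g (k - l)‖), sq_nonneg ‖dec s f l‖,
    sq_nonneg ‖dec s g (k - l)‖]

lemma prodHat_add_left {s : ℝ} (hs : 0 ≤ s) (f f' g : E2) :
    prodHat (dec s (f + f')) (dec s g) =
      prodHat (dec s f) (dec s g) + prodHat (dec s f') (dec s g) := by
  funext k
  simp only [prodHat, dec_add, Pi.add_apply, add_mul]
  exact (conv_summable hs f g k).tsum_add (conv_summable hs f' g k)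

lemma prodHat_add_right {s : ℝ} (hs : 0 ≤ s) (f g g' : E2) :
    prodHat (dec s f) (dec s (g + g')) =
      prodHat (dec s f) (dec s g) + prodHat (dec s f) (dec s g') := by
  funext k
  simp only [prodHat, dec_add, Pi.add_apply, mul_add]
  exact (conv_summable hs f g k).tsum_add (conv_summable hs f g' k)

lemma prodHat_smul_left (s : ℝ) (c : ℂ) (f g : E2) :
    prodHat (dec s (c • f)) (dec s g) = c • prodHat (dec s f) (dec s g) := by
  funext k
  simp only [prodHat, dec_smul, Pi.smul_apply, smul_eq_mul, mul_assoc, tsum_mul_left]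

lemma prodHat_smul_right (s : ℝ) (c : ℂ) (f g : E2) :
    prodHat (dec s f) (dec s (c • g)) = c • prodHat (dec s f) (dec s g) := by
  funext k
  simp only [prodHat, dec_smul, Pi.smul_apply, smul_eq_mul, mul_left_comm _ c, tsum_mul_left]

lemma phiD_add (u v : ℤ → ℂ) : phiD (u + v) = phiD u + phiD v := by
  funext k; simp [phiD, mul_add]

lemma phiD_smul (c : ℂ) (u : ℤ → ℂ) : phiD (c • u) = c • phiD u := by
  funext k; simp [phiD, mul_left_comm]

lemma exists_B (s : ℝ) (hs : 0 ≤ s) (Cs : ℝ)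
    (hbil : ∀ u v : ℤ → ℂ, MemHs s u → MemHs s v →
      MemHs s (phiD (prodHat u v)) ∧
      hsNorm s (phiD (prodHat u v)) ≤ Cs * hsNorm s u * hsNorm s v) :
    ∃ B : E2 →L[ℂ] E2 →L[ℂ] E2,
      (∀ f g, dec s (B f g) = phiD (prodHat (dec s f) (dec s g))) ∧
      ∀ f g, ‖B f g‖ ≤ Cs * ‖f‖ * ‖g‖ := by
  let b : E2 → E2 → E2 := fun f g => enc s _ (hbil _ _ (dec_mem s f) (dec_mem s g)).1
  have hb : ∀ f g, dec s (b f g) = phiD (prodHat (dec s f) (dec s g)) := fun f g => dec_enc _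
  have hn : ∀ f g, ‖b f g‖ ≤ Cs * ‖f‖ * ‖g‖ := fun f g => by
    have := (hbil _ _ (dec_mem s f) (dec_mem s g)).2
    rwa [hsNorm_dec, hsNorm_dec, ← hb, hsNorm_dec] at this
  let L : E2 →ₗ[ℂ] E2 →ₗ[ℂ] E2 := LinearMap.mk₂ ℂ b
    (fun f f' g => dec_inj (s := s) (by
      rw [dec_add, hb, hb, hb, prodHat_add_left hs, phiD_add]))
    (fun c f g => dec_inj (s := s) (by
      rw [dec_smul, hb, hb, prodHat_smul_left, phiD_smul]))
    (fun f g g' => dec_inj (s := s) (by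
      rw [dec_add, hb, hb, hb, prodHat_add_right hs, phiD_add]))
    (fun c f g => dec_inj (s := s) (by
      rw [dec_smul, hb, hb, prodHat_smul_right, phiD_smul]))
  exact ⟨L.mkContinuous₂ Cs hn, hb, hn⟩

def ex (t : ℝ) (k : ℤ) : ℂ := Complex.exp (-Complex.I * t * phiSymb k)

lemma ex_eq (t : ℝ) (k : ℤ) : ex t k = Complex.exp (Complex.I * ((-(t * phiSymb k) : ℝ) : ℂ)) := by
  unfold ex; congr 1; push_cast; ring

lemma norm_ex (t : ℝ) (k : ℤ) : ‖ex t k‖ = 1 := by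
  rw [ex_eq, mul_comm]; exact Complex.norm_exp_ofReal_mul_I _

lemma ex_add (t t' : ℝ) (k : ℤ) : ex (t + t') k = ex t k * ex t' k := by
  unfold ex; rw [← Complex.exp_add]; congr 1; push_cast; ring

lemma ex_zero (k : ℤ) : ex 0 k = 1 := by simp [ex]

lemma ex_neg_mul (t : ℝ) (k : ℤ) : ex (-t) k * ex t k = 1 := by
  rw [← ex_add, neg_add_cancel, ex_zero]

lemma abs_phi (k : ℤ) : |phiSymb k| ≤ 1 := by
  unfold phiSymb
  rw [abs_div, abs_of_pos (show (0 : ℝ) < 1 + (k : ℝ) ^ 2 by positivity), div_le_one (by positivity)]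
  rw [← sq_abs]
  nlinarith [sq_nonneg (|(k : ℝ)| - 1), abs_nonneg (k : ℝ)]

lemma norm_ex_sub_one (t : ℝ) (k : ℤ) : ‖ex t k - 1‖ ≤ |t| := by
  rw [ex_eq]
  refine (Real.norm_exp_I_mul_ofReal_sub_one_le).trans ?_
  rw [Real.norm_eq_abs, abs_neg, abs_mul]
  exact mul_le_of_le_one_right (abs_nonneg _) (abs_phi k)

lemma norm_ex_sub (t t' : ℝ) (k : ℤ) : ‖ex t k - ex t' k‖ ≤ |t - t'| := by
  have : ex t k - ex t' k = ex t' k * (ex (t - t') k - 1) := by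
    rw [mul_sub, ← ex_add]; simp
  rw [this, norm_mul, norm_ex, one_mul]
  exact norm_ex_sub_one _ _

def U (t : ℝ) : E2 →ₗᵢ[ℂ] E2 where
  toFun f := ⟨fun k => ex t k * f k, (lp.memℓp f).mono' (fun k => by simp [norm_ex])⟩
  map_add' f g := by
    ext k
    exact mul_add (ex t k) (f k) (g k)
  map_smul' c f := by
    ext k
    exact mul_left_comm (ex t k) c (f k)
  norm_map' f := by
    apply le_antisymm <;> exact lp.norm_mono (by norm_num) (fun k => by simp [norm_ex])

lemma U_apply (t : ℝ) (f : E2) (k : ℤ) : U t f k = ex t k * f k := rfl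

lemma U_neg_U (t : ℝ) (f : E2) : U (-t) (U t f) = f := by
  ext k; rw [U_apply, U_apply, ← mul_assoc, ex_neg_mul, one_mul]

lemma U_U_neg (t : ℝ) (f : E2) : U t (U (-t) f) = f := by
  simpa using U_neg_U (-t) f

lemma dec_U (s t : ℝ) (f : E2) (k : ℤ) : dec s (U t f) k = ex t k * dec s f k := by
  simp only [dec, U_apply]; ring

lemma norm_U_sub (t t' : ℝ) (f : E2) : ‖U t f - U t' f‖ ≤ |t - t'| * ‖f‖ := by
  have h : ‖U t f - U t' f‖ ≤ ‖((|t - t'| : ℝ) : ℂ) • f‖ := by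
    refine lp.norm_mono (by norm_num) (fun k => ?_)
    rw [lp.coeFn_sub, lp.coeFn_smul, Pi.sub_apply, U_apply, U_apply, ← sub_mul, norm_mul,
      Pi.smul_apply, norm_smul, Complex.norm_real, Real.norm_eq_abs, abs_abs]
    exact mul_le_mul_of_nonneg_right (norm_ex_sub t t' k) (norm_nonneg _)
  refine h.trans ?_
  rw [norm_smul, Complex.norm_real, Real.norm_eq_abs, abs_abs]

lemma U_cont : Continuous fun p : ℝ × E2 => U p.1 p.2 := by
  rw [continuous_iff_continuousAt]
  rintro ⟨t₀, f₀⟩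
  rw [ContinuousAt, tendsto_iff_norm_sub_tendsto_zero]
  have hlim : Filter.Tendsto (fun p : ℝ × E2 => ‖p.2 - f₀‖ + |p.1 - t₀| * ‖f₀‖)
      (nhds (t₀, f₀)) (nhds 0) := by
    have : Continuous (fun p : ℝ × E2 => ‖p.2 - f₀‖ + |p.1 - t₀| * ‖f₀‖) := by fun_prop
    simpa using this.tendsto (t₀, f₀)
  refine squeeze_zero (fun _ => norm_nonneg _) (fun p => ?_) hlim
  have e : U p.1 p.2 - U t₀ f₀ = U p.1 (p.2 - f₀) + (U p.1 f₀ - U t₀ f₀) := by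
    rw [map_sub]; abel
  change ‖U p.1 p.2 - U t₀ f₀‖ ≤ _
  rw [e]
  refine (norm_add_le _ _).trans ?_
  rw [LinearIsometry.norm_map]
  exact add_le_add_right (norm_U_sub _ _ _) _

lemma U_contOn {X : Type} [TopologicalSpace X] {a : X → ℝ} {w : X → E2} {S : Set X}
    (ha : ContinuousOn a S) (hw : ContinuousOn w S) : ContinuousOn (fun x => U (a x) (w x)) S :=
  Continuous.comp_continuousOn (g := fun p : ℝ × E2 => U p.1 p.2) (f := fun x => (a x, w x))
    U_cont (ha.prodMk hw)

def Fld (B : E2 →L[ℂ] E2 →L[ℂ] E2) (t : ℝ) (w : E2) : E2 :=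
  (-(Complex.I / 2)) • U (-t) (B (U t w) (U t w))

lemma Fld_cont (B : E2 →L[ℂ] E2 →L[ℂ] E2) : Continuous (Function.uncurry (Fld B)) := by
  rw [← continuousOn_univ]
  have h0 : ContinuousOn (fun p : ℝ × E2 => U p.1 p.2) Set.univ := U_cont.continuousOn
  have h1 : ContinuousOn (fun p : ℝ × E2 => B (U p.1 p.2) (U p.1 p.2)) Set.univ :=
    (B.continuous.comp_continuousOn h0).clm_apply h0
  have h2 := U_contOn (continuous_fst.neg.continuousOn) h1
  exact h2.const_smul (-(Complex.I / 2))

lemma Fld_contOn (B : E2 →L[ℂ] E2 →L[ℂ] E2) {W : ℝ → E2} {S : Set ℝ}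
    (hw : ContinuousOn W S) : ContinuousOn (fun x => Fld B x (W x)) S :=
  Continuous.comp_continuousOn (g := Function.uncurry (Fld B)) (f := fun x => (x, W x))
    (Fld_cont B) (continuousOn_id.prodMk hw)

lemma norm_I_half : ‖(-(Complex.I / 2) : ℂ)‖ = 1 / 2 := by simp

lemma Fld_norm {B : E2 →L[ℂ] E2 →L[ℂ] E2} {Cs : ℝ}
    (hB : ∀ f g, ‖B f g‖ ≤ Cs * ‖f‖ * ‖g‖) (t : ℝ) (w : E2) :
    ‖Fld B t w‖ ≤ 1 / 2 * (Cs * ‖w‖ * ‖w‖) := by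
  unfold Fld
  rw [norm_smul, norm_I_half, LinearIsometry.norm_map]
  have := hB (U t w) (U t w)
  simp only [LinearIsometry.norm_map] at this
  linarith

lemma Fld_lip {B : E2 →L[ℂ] E2 →L[ℂ] E2} {Cs : ℝ} (hCs : 0 < Cs)
    (hB : ∀ f g, ‖B f g‖ ≤ Cs * ‖f‖ * ‖g‖) (t : ℝ) (R : ℝ) (hR : 0 ≤ R) (S : Set E2)
    (hS : ∀ w ∈ S, ‖w‖ ≤ R) :
    LipschitzOnWith (Cs * R).toNNReal (Fld B t) S := by
  refine LipschitzOnWith.of_dist_le_mul fun f hf g hg => ?_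
  rw [dist_eq_norm, dist_eq_norm, Real.coe_toNNReal _ (by positivity)]
  have e : Fld B t f - Fld B t g =
      (-(Complex.I / 2)) • U (-t) (B (U t (f - g)) (U t f) + B (U t g) (U t (f - g))) := by
    unfold Fld
    rw [← smul_sub, ← map_sub]
    congr 2
    simp only [map_sub, _root_.sub_apply]
    abel
  rw [e, norm_smul, norm_I_half, LinearIsometry.norm_map]
  have h1 := hB (U t (f - g)) (U t f)
  have h2 := hB (U t g) (U t (f - g))
  simp only [LinearIsometry.norm_map] at h1 h2
  have h3 := norm_add_le (B (U t (f - g)) (U t f)) (B (U t g) (U t (f - g)))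
  have h4 : Cs * ‖f - g‖ * ‖f‖ ≤ Cs * ‖f - g‖ * R :=
    mul_le_mul_of_nonneg_left (hS f hf) (by positivity)
  have h5 : Cs * ‖g‖ * ‖f - g‖ ≤ Cs * R * ‖f - g‖ := by
    gcongr; exact hS g hg
  linarith

/-- coefficientwise version of the integral equation -/
lemma solves_iff {s : ℝ} {B : E2 →L[ℂ] E2 →L[ℂ] E2}
    (hB : ∀ f g, dec s (B f g) = phiD (prodHat (dec s f) (dec s g)))
    {u₀ : ℤ → ℂ} (hu₀ : MemHs s u₀) {T : ℝ} {W : ℝ → E2}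
    (hW : ContinuousOn W (Set.Icc (-T) T)) {u : ℝ → ℤ → ℂ}
    (hu : ∀ t ∈ Set.Icc (-T) T, u t = dec s (U t (W t)))
    {t : ℝ} (ht : t ∈ Set.Icc (-T) T) :
    SolvesBBM u₀ u t ↔ W t = ODE.picard (Fld B) 0 (enc s u₀ hu₀) W t := by
  have hT : (0 : ℝ) ∈ Set.Icc (-T) T := by
    constructor <;> linarith [ht.1, ht.2]
  have hsub : Set.uIcc 0 t ⊆ Set.Icc (-T) T := Set.uIcc_subset_Icc hT ht
  have hint : IntervalIntegrable (fun τ => Fld B τ (W τ)) MeasureTheory.volume 0 t := by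
    apply ContinuousOn.intervalIntegrable
    exact Fld_contOn B (hW.mono hsub)
  have key : ∀ k, dec s (ODE.picard (Fld B) 0 (enc s u₀ hu₀) W t) k =
      u₀ k - Complex.I / 2 * ∫ τ in (0:ℝ)..t, ex (-τ) k * (phiSymb k : ℂ) *
        prodHat (u τ) (u τ) k := by
    intro k
    rw [ODE.picard_apply, dec_add, dec_enc, Pi.add_apply, sub_eq_add_neg]
    congr 1
    have h1 : (∫ τ in (0:ℝ)..t, Fld B τ (W τ)) k = ∫ τ in (0:ℝ)..t, (Fld B τ (W τ)) k :=
      ((lp.evalCLM ℂ (fun _ : ℤ => ℂ) 2 k).intervalIntegral_comp_comm hint).symm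
    unfold dec
    rw [h1, ← intervalIntegral.integral_const_mul, ← neg_mul,
      ← intervalIntegral.integral_const_mul]
    apply intervalIntegral.integral_congr
    intro τ hτ
    have h2 : dec s (Fld B τ (W τ)) k = -(Complex.I / 2) * (ex (-τ) k * (phiSymb k : ℂ) *
        prodHat (u τ) (u τ) k) := by
      rw [hu τ (hsub hτ), Fld, dec_smul, Pi.smul_apply, smul_eq_mul, dec_U, hB, phiD]
      ring
    exact h2
  have duh : ∀ k, (∫ τ in (0:ℝ)..t, Complex.exp (-Complex.I * (t - τ) * phiSymb k) *
      (phiSymb k : ℂ) * prodHat (u τ) (u τ) k) = ex t k * ∫ τ in (0:ℝ)..t,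
        ex (-τ) k * (phiSymb k : ℂ) * prodHat (u τ) (u τ) k := by
    intro k
    rw [← intervalIntegral.integral_const_mul]
    congr 1
    funext τ
    rw [show Complex.exp (-Complex.I * (t - τ) * phiSymb k) = ex (t + -τ) k by
      unfold ex; push_cast; rw [sub_eq_add_neg], ex_add]
    ring
  have hne : ∀ k, ex t k ≠ 0 := fun k => Complex.exp_ne_zero _
  have step : SolvesBBM u₀ u t ↔ ∀ k, dec s (W t) k =
      dec s (ODE.picard (Fld B) 0 (enc s u₀ hu₀) W t) k := by
    unfold SolvesBBM
    refine forall_congr' fun k => ?_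
    rw [key, duh, hu t ht, dec_U, show freeEvol t u₀ k = ex t k * u₀ k from rfl]
    rw [mul_left_comm, ← mul_sub]
    exact mul_right_inj' (hne k)
  rw [step]
  exact ⟨fun h => dec_inj (funext h), fun h k => by rw [← h]⟩

lemma exists_sol {s : ℝ} {B : E2 →L[ℂ] E2 →L[ℂ] E2} {Cs : ℝ} (hCs : 0 < Cs)
    (hB : ∀ f g, dec s (B f g) = phiD (prodHat (dec s f) (dec s g)))
    (hBn : ∀ f g, ‖B f g‖ ≤ Cs * ‖f‖ * ‖g‖)
    {u₀ : ℤ → ℂ} (hu₀ : MemHs s u₀) {T : ℝ} (hT : 0 < T)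
    (hTs : T * (4 * Cs * hsNorm s u₀) < 1) : ∃ u : ℝ → ℤ → ℂ, IsSolOn s T u₀ u := by
  have hN := norm_enc hu₀
  set w₀ := enc s u₀ hu₀ with hw₀
  obtain ⟨a, ha⟩ : ∃ a : ℝ, a = 1 / (4 * Cs * T) := ⟨_, rfl⟩
  have ha0 : 0 < a := by rw [ha]; positivity
  have haT : 4 * Cs * T * a = 1 := by rw [ha]; field_simp
  have hNa : ‖w₀‖ ≤ a := by
    rw [ha, le_div_iff₀ (by positivity), hN]; linarith
  have hball : ∀ w ∈ Metric.closedBall w₀ (a.toNNReal : ℝ), ‖w‖ ≤ 2 * a := by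
    intro w hw
    rw [Real.coe_toNNReal _ ha0.le, mem_closedBall_iff_norm] at hw
    have := norm_add_le (w - w₀) w₀
    rw [sub_add_cancel] at this
    linarith
  have hL : (0 : ℝ) ≤ 2 * Cs * a * a := by positivity
  have h0 : (0 : ℝ) ∈ Set.Icc (-T) T := ⟨by linarith, hT.le⟩
  have pl : IsPicardLindelof (Fld B) (⟨0, h0⟩ : Set.Icc (-T) T) w₀ a.toNNReal 0
      (2 * Cs * a * a).toNNReal (Cs * (2 * a)).toNNReal := by
    refine ⟨fun t _ => Fld_lip hCs hBn t (2 * a) (by positivity) _ hball, fun x _ => ?_,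
      fun t _ x hx => ?_, ?_⟩
    · exact Fld_contOn B (W := fun _ => x) continuousOn_const
    · rw [Real.coe_toNNReal _ hL]
      refine (Fld_norm hBn t x).trans ?_
      have h1 := hball x hx
      have h2 : ‖x‖ * ‖x‖ ≤ (2 * a) * (2 * a) := by gcongr
      nlinarith
    · rw [Real.coe_toNNReal _ hL, Real.coe_toNNReal _ ha0.le]
      simp only [sub_zero, zero_sub, neg_neg, max_self, NNReal.coe_zero]
      have : 2 * Cs * a * a * T = a / 2 := by linear_combination (a / 2) * haT
      linarith
  obtain ⟨W, hW0, hW⟩ := pl.exists_eq_forall_mem_Icc_hasDerivWithinAt₀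
  have hWc : ContinuousOn W (Set.Icc (-T) T) := HasDerivWithinAt.continuousOn hW
  refine ⟨fun t => dec s (U t (W t)), ⟨fun t _ => dec_mem s _, ?_⟩, fun t ht => ?_⟩
  · have hV : ContinuousOn (fun t => U t (W t)) (Set.Icc (-T) T) :=
      U_contOn continuousOn_id hWc
    intro t₀ ht₀ ε hε
    obtain ⟨δ, hδ, h⟩ := Metric.continuousOn_iff.1 hV t₀ ht₀ ε hε
    refine ⟨δ, hδ, fun t ht htd => ?_⟩
    have := h t ht (by rwa [Real.dist_eq])
    rw [dist_eq_norm, ← hsNorm_dec s, dec_sub] at this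
    exact this
  · rw [solves_iff hB hu₀ hWc (fun _ _ => rfl) ht]
    have hsub : Set.uIcc 0 t ⊆ Set.Icc (-T) T := Set.uIcc_subset_Icc h0 ht
    have := ODE.picard_eq_of_hasDerivAt (f := Fld B) (α := W) (u := Set.univ) (t₀ := 0) (t := t)
      (Fld_cont B).continuousOn (fun t' ht' => (hW t' (hsub ht')).mono hsub)
      (Set.mapsTo_univ _ _)
    simp only at hW0
    rw [hW0] at this
    exact this.symm

/-- every solution comes from a solution of the ODE -/
lemma sol_ode {s : ℝ} {B : E2 →L[ℂ] E2 →L[ℂ] E2}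
    (hB : ∀ f g, dec s (B f g) = phiD (prodHat (dec s f) (dec s g)))
    {u₀ : ℤ → ℂ} (hu₀ : MemHs s u₀) {T : ℝ} (hT : 0 < T) {u : ℝ → ℤ → ℂ}
    (hu : IsSolOn s T u₀ u) :
    ∃ W : ℝ → E2, ContinuousOn W (Set.Icc (-T) T) ∧
      (∀ t ∈ Set.Icc (-T) T, u t = dec s (U t (W t))) ∧ W 0 = enc s u₀ hu₀ ∧
      ∀ t ∈ Set.Icc (-T) T, HasDerivWithinAt W (Fld B t (W t)) (Set.Icc (-T) T) t := by
  classical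
  obtain ⟨⟨hm, hc⟩, hsol⟩ := hu
  have h0 : (0 : ℝ) ∈ Set.Icc (-T) T := ⟨by linarith, hT.le⟩
  let V : ℝ → E2 := fun t => if h : MemHs s (u t) then enc s (u t) h else 0
  have hVd : ∀ t ∈ Set.Icc (-T) T, dec s (V t) = u t := fun t ht => by
    simp only [V, dif_pos (hm t ht), dec_enc]
  have hVc : ContinuousOn V (Set.Icc (-T) T) := by
    rw [Metric.continuousOn_iff]
    intro t₀ ht₀ ε hε
    obtain ⟨δ, hδ, h⟩ := hc t₀ ht₀ ε hε
    refine ⟨δ, hδ, fun t ht htd => ?_⟩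
    have := h t ht (by rwa [Real.dist_eq] at htd)
    rw [dist_eq_norm, ← hsNorm_dec s, dec_sub, hVd t ht, hVd t₀ ht₀]
    exact this
  let W : ℝ → E2 := fun t => U (-t) (V t)
  have hWc : ContinuousOn W (Set.Icc (-T) T) :=
    U_contOn continuousOn_neg hVc
  have hud : ∀ t ∈ Set.Icc (-T) T, u t = dec s (U t (W t)) := fun t ht => by
    simp only [W, U_U_neg, hVd t ht]
  have hpic : ∀ t ∈ Set.Icc (-T) T, W t = ODE.picard (Fld B) 0 (enc s u₀ hu₀) W t :=
    fun t ht => (solves_iff hB hu₀ hWc hud ht).1 (hsol t ht)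
  refine ⟨W, hWc, hud, ?_, fun t ht => ?_⟩
  · rw [hpic 0 h0, ODE.picard_apply₀]
  · have := ODE.hasDerivWithinAt_picard_Icc (f := Fld B) (u := Set.univ) h0
      (Fld_cont B).continuousOn hWc (fun _ _ => Set.mem_univ _) (enc s u₀ hu₀) ht
    exact this.congr_of_mem hpic ht

lemma unique_sol {s : ℝ} {B : E2 →L[ℂ] E2 →L[ℂ] E2} {Cs : ℝ} (hCs : 0 < Cs)
    (hB : ∀ f g, dec s (B f g) = phiD (prodHat (dec s f) (dec s g)))
    (hBn : ∀ f g, ‖B f g‖ ≤ Cs * ‖f‖ * ‖g‖)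
    {u₀ : ℤ → ℂ} (hu₀ : MemHs s u₀) {T : ℝ} (hT : 0 < T) {u v : ℝ → ℤ → ℂ}
    (hu : IsSolOn s T u₀ u) (hv : IsSolOn s T u₀ v) : ∀ t ∈ Set.Icc (-T) T, u t = v t := by
  obtain ⟨W, hWc, hWd, hW0, hW⟩ := sol_ode hB hu₀ hT hu
  obtain ⟨Z, hZc, hZd, hZ0, hZ⟩ := sol_ode hB hu₀ hT hv
  obtain ⟨R₁, hR₁⟩ := isCompact_Icc.exists_bound_of_continuousOn hWc
  obtain ⟨R₂, hR₂⟩ := isCompact_Icc.exists_bound_of_continuousOn hZc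
  have h0 : (0 : ℝ) ∈ Set.Ioo (-T) T := ⟨by linarith, hT⟩
  have hR : 0 ≤ max R₁ R₂ :=
    ((norm_nonneg _).trans (hR₁ 0 (Set.Ioo_subset_Icc_self h0))).trans (le_max_left _ _)
  have hEq := ODE_solution_unique_of_mem_Icc (v := Fld B) (s := fun _ => {w | ‖w‖ ≤ max R₁ R₂})
    (K := (Cs * max R₁ R₂).toNNReal) (f := W) (g := Z) (t₀ := 0) (a := -T) (b := T)
    (fun t _ => Fld_lip hCs hBn t _ hR _ (fun w hw => hw)) h0 hWc
    (fun t ht => (hW t (Set.Ioo_subset_Icc_self ht)).hasDerivAt (Icc_mem_nhds ht.1 ht.2))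
    (fun t ht => (hR₁ t (Set.Ioo_subset_Icc_self ht)).trans (le_max_left _ _)) hZc
    (fun t ht => (hZ t (Set.Ioo_subset_Icc_self ht)).hasDerivAt (Icc_mem_nhds ht.1 ht.2))
    (fun t ht => (hR₂ t (Set.Ioo_subset_Icc_self ht)).trans (le_max_right _ _))
    (hW0.trans hZ0.symm)
  intro t ht
  rw [hWd t ht, hZd t ht, hEq ht]


/-- Local well-posedness of BBM in `H^s(𝕋)`, `s ≥ 0`: for every
`u₀ ∈ H^s(𝕋)` there are a time `T > 0` and a unique solution `u ∈ X^s_T` of the BBM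
integral equation; moreover a solution exists on `[-T,T]` for every
`T < 1/(4 C_s ‖u₀‖_{H^s})`, where `C_s` is any constant realizing the bilinear estimate
`‖φ(D)(uv)‖_{H^s} ≤ C_s ‖u‖_{H^s} ‖v‖_{H^s}`. -/
theorem local_wellposedness
    (s : ℝ) (hs : 0 ≤ s) (Cs : ℝ) (hCs : 0 < Cs)
    (hbil : ∀ u v : ℤ → ℂ, MemHs s u → MemHs s v →
      MemHs s (phiD (prodHat u v)) ∧
      hsNorm s (phiD (prodHat u v)) ≤ Cs * hsNorm s u * hsNorm s v)
    (u₀ : ℤ → ℂ) (hu₀ : MemHs s u₀) :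
    (∃ T : ℝ, 0 < T ∧ (∃ u : ℝ → ℤ → ℂ, IsSolOn s T u₀ u) ∧
      ∀ u v : ℝ → ℤ → ℂ, IsSolOn s T u₀ u → IsSolOn s T u₀ v →
        ∀ t ∈ Set.Icc (-T) T, u t = v t) ∧
    (∀ T : ℝ, 0 < T → T * (4 * Cs * hsNorm s u₀) < 1 →
      ∃ u : ℝ → ℤ → ℂ, IsSolOn s T u₀ u) := by
  obtain ⟨B, hB, hBn⟩ := exists_B s hs Cs hbil
  refine ⟨?_, fun T hT hTs => exists_sol hCs hB hBn hu₀ hT hTs⟩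
  have hN : 0 ≤ hsNorm s u₀ := Real.sqrt_nonneg _
  have hpos : 0 < 1 / (4 * Cs * (hsNorm s u₀ + 1)) := by positivity
  refine ⟨_, hpos, exists_sol hCs hB hBn hu₀ hpos ?_,
    fun u v hu hv => unique_sol hCs hB hBn hu₀ hpos hu hv⟩
  rw [div_mul_eq_mul_div, one_mul, div_lt_one (by positivity)]
  nlinarith

end BBM
end
end

section
/- Let s ≥ 0 and R > 0, and let T be a uniform local existence time for the BBM equation for all initial data in the ball B_R(H^s(T)) (such T exists, e.g. T = 1/(2C_s·2R)). Then the flow map Φ : u₀ ↦ u, associating to u₀ the solution of the BBM integral equation, is real-analytic from B_R(H^s(T)) to X^s_T = C⁰([−T,T], H^s(T)). -/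
open scoped BigOperators ComplexConjugate ENNReal
open Complex

noncomputable section

namespace BBMFlow

/-!  We work on the torus `𝕋 = ℝ/2πℤ` at the level of Fourier coefficients.  The Sobolev
space `H^s(𝕋)` of real-valued functions is isometrically identified with the space
`realSub` of sequences `v ∈ ℓ²(ℤ, ℂ)` with `v(-k) = conj (v k)`, an element `v` representing
the function with Fourier coefficients `û(k) = ⟨k⟩^{-s} v(k)`, `⟨k⟩ = (1+k²)^{1/2}`;
then `‖v‖_{ℓ²} = ‖u‖_{H^s}` and the reality condition on `û` is equivalent to that on `v`.
The space `X^s_T = C⁰([-T,T], H^s(𝕋))` is then `C(Set.Icc (-T) T, realSub)` with its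
sup-norm.  The pointwise product corresponds to convolution of Fourier coefficients. -/

/-- The sequence space `ℓ²(ℤ, ℂ)`, regarded as a real normed space. -/
abbrev SeqLp : Type := lp (fun _ : ℤ => ℂ) 2

/-- The (real) subspace of sequences satisfying the reality condition `v(-k) = conj v(k)`,
which models real-valued functions. -/
def realSub : Submodule ℝ SeqLp where
  carrier := {v : SeqLp | ∀ k : ℤ, v (-k) = conj (v k)}
  add_mem' := by
    intro a b ha hb k
    simp only [lp.coeFn_add, Pi.add_apply, Set.mem_setOf_eq] at *
    rw [ha k, hb k, map_add]
  zero_mem' := by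
    intro k
    simp [lp.coeFn_zero]
  smul_mem' := by
    intro c v hv k
    simp only [lp.coeFn_smul, Pi.smul_apply, Set.mem_setOf_eq] at *
    rw [hv k]
    simp [Complex.real_smul, map_mul]

/-- The Fourier coefficient `û(k) = ⟨k⟩^{-s} v(k)` of the `H^s` function represented by
`v ∈ realSub`. -/
def coeffAt (s : ℝ) (v : realSub) (k : ℤ) : ℂ :=
  (((1 + (k : ℝ) ^ 2) ^ (-(s / 2)) : ℝ) : ℂ) * (v : SeqLp) k

/-- The symbol `φ(k) = k/(1+k²)` of the Fourier multiplier `φ(D)`. -/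
def phiSymb (k : ℤ) : ℝ := (k : ℝ) / (1 + (k : ℝ) ^ 2)

/-- The Fourier coefficients, extended by `0` outside `[-T,T]`, of a curve
`U ∈ C⁰([-T,T], H^s(𝕋))`. -/
def uc (s T : ℝ) (U : C(Set.Icc (-T) T, realSub)) (τ : ℝ) (k : ℤ) : ℂ :=
  if h : τ ∈ Set.Icc (-T) T then coeffAt s (U ⟨τ, h⟩) k else 0

/-- `U ∈ X^s_T = C⁰([-T,T], H^s(𝕋))` solves the BBM integral equation
`u(t) = e^{-itφ(D)}u₀ - (i/2) ∫₀ᵗ e^{-i(t-τ)φ(D)} φ(D)(u(τ)²) dτ` with initial data `u₀`,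
written coefficientwise (the Fourier coefficients of `u(τ)²` being the convolution square
of those of `u(τ)`). -/
def IsBBMSol (s T : ℝ) (u₀ : realSub) (U : C(Set.Icc (-T) T, realSub)) : Prop :=
  ∀ t ∈ Set.Icc (-T) T, ∀ k : ℤ,
    uc s T U t k = Complex.exp (-Complex.I * t * phiSymb k) * coeffAt s u₀ k -
      (Complex.I / 2) * ∫ τ in (0:ℝ)..t,
        Complex.exp (-Complex.I * (t - τ) * phiSymb k) * ((phiSymb k : ℝ) : ℂ) *
          ∑' l : ℤ, uc s T U τ l * uc s T U τ (k - l)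



section Abstract

variable {E : Type*} [NormedAddCommGroup E] [NormedSpace ℝ E]

/-- Volterra bilinear operator. -/
def volt {T : ℝ} (hT : -T ≤ T) (S : ℝ → E →L[ℝ] E) (hS : Continuous S)
    (B : E →L[ℝ] E →L[ℝ] E) (U V : C(Set.Icc (-T) T, E)) : C(Set.Icc (-T) T, E) where
  toFun t := ∫ τ in (0:ℝ)..t, S (t - τ) (B (U (Set.projIcc _ _ hT τ)) (V (Set.projIcc _ _ hT τ)))
  continuous_toFun := by
    have h1 : Continuous (Set.projIcc (-T) T hT) := continuous_projIcc
    refine intervalIntegral.continuous_parametric_intervalIntegral_of_continuous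
      (f := fun (t : Set.Icc (-T) T) (τ : ℝ) => S (t - τ)
        (B (U (Set.projIcc _ _ hT τ)) (V (Set.projIcc _ _ hT τ)))) ?_ continuous_subtype_val
    unfold Function.uncurry
    fun_prop

lemma volt_cont {T : ℝ} (hT : -T ≤ T) (S : ℝ → E →L[ℝ] E) (hS : Continuous S)
    (B : E →L[ℝ] E →L[ℝ] E) (U V : C(Set.Icc (-T) T, E)) (t : ℝ) :
    Continuous fun τ => S (t - τ) (B (U (Set.projIcc _ _ hT τ)) (V (Set.projIcc _ _ hT τ))) := by
  have h1 : Continuous (Set.projIcc (-T) T hT) := continuous_projIcc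
  fun_prop

lemma volt_bound {T : ℝ} (hT : -T ≤ T) (S : ℝ → E →L[ℝ] E) (hS : Continuous S)
    (B : E →L[ℝ] E →L[ℝ] E) : ∃ M : ℝ, 0 ≤ M ∧ ∀ (U V : C(Set.Icc (-T) T, E)) (a : ℝ) (n : ℕ),
      (∀ t, ‖V t‖ ≤ a * |(t:ℝ)| ^ n / n.factorial) →
      ∀ t, ‖volt hT S hS B U V t‖ ≤
        (M * ‖U‖ * a) * |(t:ℝ)| ^ (n+1) / (n+1).factorial := by
  obtain ⟨M, hM⟩ := (isCompact_Icc (a := -(2*T)) (b := 2*T)).exists_bound_of_continuousOn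
    hS.continuousOn
  have hM0 : 0 ≤ M := (norm_nonneg _).trans (hM 0 (by constructor <;> linarith))
  refine ⟨M * ‖B‖, by positivity, fun U V a n hV t => ?_⟩
  obtain ⟨t, ht⟩ := t
  simp only [volt, ContinuousMap.coe_mk]
  refine (intervalIntegral.norm_integral_le_integral_norm_uIoc).trans ?_
  have key : ∀ τ ∈ Set.uIoc 0 t, ‖S (t - τ) (B (U (Set.projIcc _ _ hT τ))
      (V (Set.projIcc _ _ hT τ)))‖ ≤ (M * ‖B‖ * ‖U‖ * a / n.factorial) * |τ - 0| ^ n := by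
    intro τ hτ
    have hτ' : τ ∈ Set.Icc (-T) T := by
      have := Set.uIoc_subset_uIcc hτ
      refine Set.uIcc_subset_Icc ⟨by linarith, by linarith⟩ ht this
    have e : ((Set.projIcc (-T) T hT τ : Set.Icc (-T) T) : ℝ) = τ := by
      rw [Set.projIcc_of_mem hT hτ']
    have h1 := hV (Set.projIcc (-T) T hT τ)
    rw [e] at h1
    have h2 := hM (t - τ) ⟨by linarith [ht.1, hτ'.2], by linarith [ht.2, hτ'.1]⟩
    calc _ ≤ M * (‖B‖ * ‖U‖ * (a * |τ| ^ n / n.factorial)) := by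
          refine (ContinuousLinearMap.le_of_opNorm_le _ h2 _).trans ?_
          gcongr
          refine (B.le_opNorm₂ _ _).trans ?_
          gcongr
          exact U.norm_coe_le_norm _
      _ = _ := by rw [sub_zero]; ring
  refine (MeasureTheory.setIntegral_mono_on ?_ ?_ measurableSet_uIoc key).trans ?_
  · exact (((volt_cont hT S hS B U V t).norm).intervalIntegrable 0 t).def'
  · have : Continuous fun τ : ℝ => (M * ‖B‖ * ‖U‖ * a / n.factorial) * |τ - 0| ^ n := by fun_prop
    exact (this.intervalIntegrable 0 t).def'
  · rw [MeasureTheory.integral_const_mul, integral_pow_abs_sub_uIoc, sub_zero, Nat.factorial_succ]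
    push_cast
    apply le_of_eq
    field_simp

/-- The continuous bilinear version. -/
def voltL {T : ℝ} (hT : -T ≤ T) (S : ℝ → E →L[ℝ] E) (hS : Continuous S)
    (B : E →L[ℝ] E →L[ℝ] E) :
    C(Set.Icc (-T) T, E) →L[ℝ] C(Set.Icc (-T) T, E) →L[ℝ] C(Set.Icc (-T) T, E) :=
  LinearMap.mkContinuousOfExistsBound₂ (LinearMap.mk₂ ℝ (volt hT S hS B)
    (fun U U' V => by
      ext t
      simp only [volt, ContinuousMap.coe_mk, ContinuousMap.add_apply]
      rw [← intervalIntegral.integral_add ((volt_cont hT S hS B _ _ _).intervalIntegrable _ _)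
        ((volt_cont hT S hS B _ _ _).intervalIntegrable _ _)]
      simp)
    (fun c U V => by
      ext t
      simp only [volt, ContinuousMap.coe_mk, ContinuousMap.smul_apply]
      rw [← intervalIntegral.integral_smul]
      simp)
    (fun U V V' => by
      ext t
      simp only [volt, ContinuousMap.coe_mk, ContinuousMap.add_apply]
      rw [← intervalIntegral.integral_add ((volt_cont hT S hS B _ _ _).intervalIntegrable _ _)
        ((volt_cont hT S hS B _ _ _).intervalIntegrable _ _)]
      simp)
    (fun c U V => by
      ext t
      simp only [volt, ContinuousMap.coe_mk, ContinuousMap.smul_apply]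
      rw [← intervalIntegral.integral_smul]
      simp))
  (by
    obtain ⟨M, hM0, hM⟩ := volt_bound hT S hS B
    refine ⟨M * T, fun U V => ?_⟩
    have hT0 : 0 ≤ T := by linarith
    rw [ContinuousMap.norm_le _ (by positivity)]
    intro t
    refine (hM U V ‖V‖ 0 (fun t => by simpa using V.norm_coe_le_norm t) t).trans ?_
    have : |(t:ℝ)| ≤ T := abs_le.2 t.2
    simp only [zero_add, pow_one, Nat.factorial_one, Nat.cast_one, div_one]
    calc _ ≤ M * ‖U‖ * ‖V‖ * T := by gcongr
      _ = _ := by ring)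

lemma voltL_apply {T : ℝ} (hT : -T ≤ T) (S : ℝ → E →L[ℝ] E) (hS : Continuous S)
    (B : E →L[ℝ] E →L[ℝ] E) (U V : C(Set.Icc (-T) T, E)) :
    voltL hT S hS B U V = volt hT S hS B U V := rfl

lemma voltL_isUnit [CompleteSpace E] {T : ℝ} (hT : -T ≤ T) (S : ℝ → E →L[ℝ] E)
    (hS : Continuous S) (B : E →L[ℝ] E →L[ℝ] E) (U : C(Set.Icc (-T) T, E)) :
    IsUnit (1 - voltL hT S hS B U) := by
  obtain ⟨M, hM0, hM⟩ := volt_bound hT S hS B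
  have hT0 : 0 ≤ T := by linarith
  set L := voltL hT S hS B U with hL
  have hpow : ∀ (n : ℕ) (V : C(Set.Icc (-T) T, E)) (t : Set.Icc (-T) T),
      ‖(L ^ n) V t‖ ≤ ((M * ‖U‖) ^ n * ‖V‖) * |(t:ℝ)| ^ n / n.factorial := by
    intro n V
    induction n with
    | zero => intro t; simpa using V.norm_coe_le_norm t
    | succ n ih =>
      intro t
      rw [pow_succ']
      refine (hM U ((L ^ n) V) _ n ih t).trans (le_of_eq ?_)
      ring
  have hnorm : ∀ n : ℕ, ‖L ^ n‖ ≤ (M * ‖U‖ * T) ^ n / n.factorial := by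
    intro n
    refine ContinuousLinearMap.opNorm_le_bound _ (by positivity) fun V => ?_
    rw [ContinuousMap.norm_le _ (by positivity)]
    intro t
    refine (hpow n V t).trans ?_
    have : |(t:ℝ)| ≤ T := abs_le.2 t.2
    calc _ ≤ ((M * ‖U‖) ^ n * ‖V‖) * T ^ n / n.factorial := by gcongr
      _ = _ := by rw [mul_pow (M * ‖U‖)]; ring
  have hlim := FloorSemiring.tendsto_pow_div_factorial_atTop (M * ‖U‖ * T)
  obtain ⟨n, hn⟩ := (hlim.eventually (gt_mem_nhds zero_lt_one)).exists
  have hu : IsUnit (1 - L ^ n) := isUnit_one_sub_of_norm_lt_one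
    (R := C(Set.Icc (-T) T, E) →L[ℝ] C(Set.Icc (-T) T, E)) ((hnorm n).trans_lt hn)
  have hc : Commute (1 - L) (∑ i ∈ Finset.range n, L ^ i) := by
    refine Commute.sum_right _ _ _ fun i _ => ?_
    exact (Commute.one_left _).sub_left ((Commute.refl L).pow_right i)
  rw [← mul_neg_geom_sum, hc.isUnit_mul_iff] at hu
  exact hu.1

theorem abstract_analytic [CompleteSpace E] {T : ℝ} (hT : -T ≤ T) (S : ℝ → E →L[ℝ] E)
    (hS : Continuous S) (B : E →L[ℝ] E →L[ℝ] E)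
    (hB : ∀ x y, B x y = B y x) (Φ : E → C(Set.Icc (-T) T, E))
    (D : Set E) (hD : IsOpen D)
    (hΦ : ∀ u ∈ D, ∀ t : Set.Icc (-T) T, Φ u t = S t u +
      volt hT S hS B (Φ u) (Φ u) t) : AnalyticOnNhd ℝ Φ D := by
  have hT0 : 0 ≤ T := by linarith
  set N := voltL hT S hS B with hN
  -- linear flow
  obtain ⟨M, hM⟩ := (isCompact_Icc (a := -T) (b := T)).exists_bound_of_continuousOn
    hS.continuousOn
  have hM0 : 0 ≤ M := (norm_nonneg _).trans (hM 0 (by constructor <;> linarith))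
  let G₀ : E →ₗ[ℝ] C(Set.Icc (-T) T, E) :=
    { toFun := fun u => ⟨fun t => S t u, by fun_prop⟩
      map_add' := fun u v => by ext t; simp
      map_smul' := fun c u => by ext t; simp }
  let G : E →L[ℝ] C(Set.Icc (-T) T, E) := G₀.mkContinuous M (fun u => by
    rw [ContinuousMap.norm_le _ (by positivity)]
    intro t
    exact ContinuousLinearMap.le_of_opNorm_le _ (hM t t.2) u)
  let Ψ : C(Set.Icc (-T) T, E) → C(Set.Icc (-T) T, E) := fun U => U - N U U
  have hΨΦ : ∀ u ∈ D, Ψ (Φ u) = G u := by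
    intro u hu
    ext t
    have := hΦ u hu t
    change Φ u t - volt hT S hS B (Φ u) (Φ u) t = S t u
    rw [sub_eq_iff_eq_add]; exact this
  have hsymm : ∀ W V, N W V = N V W := by
    intro W V
    ext t
    change ∫ τ in (0:ℝ)..t, _ = ∫ τ in (0:ℝ)..t, _
    simp only [hB (W _)]
  have hinj : Function.Injective Ψ := by
    intro U V hUV
    obtain ⟨w, hw⟩ := voltL_isUnit hT S hS B (U + V)
    have h1 : (1 - N (U + V)) (U - V) = 0 := by
      have : U - N U U = V - N V V := hUV
      have h2 : (1 - N (U + V)) (U - V) = (U - N U U) - (V - N V V) := by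
        simp only [sub_apply, one_apply_eq_self, map_add, map_sub,
          add_apply, hsymm V U]
        abel
      rw [h2, this, sub_self]
    have h3 : (((w⁻¹ : (C(Set.Icc (-T) T, E) →L[ℝ] C(Set.Icc (-T) T, E))ˣ) :
        C(Set.Icc (-T) T, E) →L[ℝ] C(Set.Icc (-T) T, E)) * w) (U - V) = 0 := by
      rw [mul_apply_eq_comp, hw, h1, map_zero]
    rw [Units.inv_mul, one_apply_eq_self] at h3
    exact sub_eq_zero.1 h3
  intro u hu
  have han : ∀ U, AnalyticAt ℝ Ψ U := by
    intro U
    exact analyticAt_id.sub ((N.analyticAt_bilinear (U, U)).comp₂ analyticAt_id analyticAt_id)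
  obtain ⟨w, hw⟩ := voltL_isUnit hT S hS B ((2:ℝ) • Φ u)
  let e : C(Set.Icc (-T) T, E) ≃L[ℝ] C(Set.Icc (-T) T, E) := ContinuousLinearEquiv.unitsEquiv ℝ _ w
  have hderiv : HasFDerivAt Ψ (e : C(Set.Icc (-T) T, E) →L[ℝ] C(Set.Icc (-T) T, E)) (Φ u) := by
    have h1 := (hasFDerivAt_id (𝕜 := ℝ) (Φ u)).sub
      (N.hasFDerivAt_of_bilinear (hasFDerivAt_id (𝕜 := ℝ) (Φ u)) (hasFDerivAt_id (𝕜 := ℝ) (Φ u)))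
    refine h1.congr_fderiv ?_
    have h2 : (e : C(Set.Icc (-T) T, E) →L[ℝ] C(Set.Icc (-T) T, E)) = 1 - N ((2:ℝ) • Φ u) := hw
    rw [h2]
    refine ContinuousLinearMap.ext fun V => ?_
    simp [two_smul, hsymm V, ContinuousLinearMap.precompR, ContinuousLinearMap.precompL]
  have hstrict : HasStrictFDerivAt Ψ (e : C(Set.Icc (-T) T, E) →L[ℝ] C(Set.Icc (-T) T, E)) (Φ u) := by
    have := (han (Φ u)).hasStrictFDerivAt
    rwa [hderiv.fderiv] at this
  have hginv : AnalyticAt ℝ (hstrict.localInverse Ψ e (Φ u)) (Ψ (Φ u)) :=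
    (hstrict.toOpenPartialHomeomorph Ψ).analyticAt_symm' hstrict.mem_toOpenPartialHomeomorph_source
      (han (Φ u)) hderiv.fderiv
  rw [hΨΦ u hu] at hginv
  have hcomp : AnalyticAt ℝ (fun v => hstrict.localInverse Ψ e (Φ u) (G v)) u :=
    hginv.comp (G.analyticAt u)
  refine hcomp.congr ?_
  have hev := hstrict.eventually_right_inverse
  rw [hΨΦ u hu] at hev
  filter_upwards [G.continuous.continuousAt.eventually hev, hD.mem_nhds hu] with v hv hvD
  apply hinj
  rw [hv, hΨΦ v hvD]

/-- One-parameter group. -/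
def expg (A : E →L[ℝ] E) (t : ℝ) : E →L[ℝ] E := NormedSpace.exp (t • A)

lemma expg_cont [CompleteSpace E] (A : E →L[ℝ] E) : Continuous (expg A) := by
  have h : Continuous (NormedSpace.exp : (E →L[ℝ] E) → _) := by
    rw [← continuousOn_univ]
    simpa using (NormedSpace.exp_hasFPowerSeriesOnBall (𝕂 := ℝ)
      (𝔸 := E →L[ℝ] E)).continuousOn
  exact h.comp (continuous_id.smul continuous_const)

lemma expg_apply [CompleteSpace E] (A : E →L[ℝ] E) (e : E →L[ℝ] ℂ) (z : ℂ)
    (hz : ∀ v, e (A v) = z * e v) (t : ℝ) (v : E) :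
    e (expg A t v) = Complex.exp (t * z) * e v := by
  have h1 := NormedSpace.exp_series_hasSum_exp' (𝕂 := ℝ) (t • A)
  have h2 := (e.comp (ContinuousLinearMap.apply ℝ E v)).hasSum h1
  have h3 := (NormedSpace.exp_series_hasSum_exp' (𝕂 := ℝ) (t * z)).mul_right (e v)
  rw [← Complex.exp_eq_exp_ℂ] at h3
  refine HasSum.unique (f := fun n : ℕ => ((n.factorial : ℝ)⁻¹ • (t * z) ^ n) * e v) ?_ h3
  have hp : ∀ n : ℕ, e (((t • A) ^ n) v) = (t * z) ^ n * e v := by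
    intro n
    induction n with
    | zero => simp
    | succ n ih =>
      rw [pow_succ']
      change e (t • A (((t • A) ^ n) v)) = _
      rw [map_smul, hz, ih, Complex.real_smul]
      ring
  have h4 : HasSum (fun n : ℕ => e (((n.factorial : ℝ)⁻¹ • (t • A) ^ n) v)) (e (expg A t v)) := h2
  convert h4 using 1
  ext n
  change _ = e ((n.factorial : ℝ)⁻¹ • ((t • A) ^ n) v)
  rw [map_smul, hp, smul_mul_assoc]

end Abstract

section Concrete

lemma two_toReal_pos : 0 < (2 : ℝ≥0∞).toReal := by norm_num

lemma memlp_of_le (f : ℤ → ℂ) (g : SeqLp) (h : ∀ k, ‖f k‖ ≤ ‖g k‖) : Memℓp f 2 := by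
  refine memℓp_gen ?_
  refine Summable.of_nonneg_of_le (fun k => by positivity) (fun k => ?_)
    (lp.hasSum_norm two_toReal_pos g).summable
  exact Real.rpow_le_rpow (norm_nonneg _) (h k) two_toReal_pos.le

/-- Build an element of `realSub` from a dominated sequence. -/
def mkR (f : ℤ → ℂ) (g : SeqLp) (h : ∀ k, ‖f k‖ ≤ ‖g k‖) (hr : ∀ k, f (-k) = conj (f k)) :
    realSub := ⟨⟨f, memlp_of_le f g h⟩, hr⟩

lemma mkR_norm (f : ℤ → ℂ) (g : SeqLp) (h : ∀ k, ‖f k‖ ≤ ‖g k‖)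
    (hr : ∀ k, f (-k) = conj (f k)) : ‖mkR f g h hr‖ ≤ ‖g‖ := by
  change ‖(⟨f, memlp_of_le f g h⟩ : SeqLp)‖ ≤ ‖g‖
  exact lp.norm_mono (by norm_num) h

lemma realSub_ext {u v : realSub} (h : ∀ k, (u : SeqLp) k = (v : SeqLp) k) : u = v :=
  Subtype.ext (lp.ext (funext h))

/-- Coefficient functional. -/
def evL (k : ℤ) : realSub →L[ℝ] ℂ :=
  LinearMap.mkContinuous
    { toFun := fun v => (v : SeqLp) k
      map_add' := fun u v => by simp
      map_smul' := fun c u => by simp } 1 (fun v => by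
        rw [one_mul]
        exact lp.norm_apply_le_norm (by norm_num) (v : SeqLp) k)

lemma evL_apply (k : ℤ) (v : realSub) : evL k v = (v : SeqLp) k := rfl

lemma continuous_coord (k : ℤ) : Continuous fun v : SeqLp => v k := by
  have : LipschitzWith 1 fun v : SeqLp => v k := by
    refine LipschitzWith.of_dist_le_mul fun u v => ?_
    rw [NNReal.coe_one, one_mul, dist_eq_norm, dist_eq_norm]
    exact lp.norm_apply_le_norm (by norm_num) (u - v) k
  exact this.continuous

instance : CompleteSpace realSub := by
  have : IsClosed (realSub : Set SeqLp) := by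
    have h : (realSub : Set SeqLp) = ⋂ k : ℤ, {v : SeqLp | v (-k) = conj (v k)} := by
      ext v
      rw [Set.mem_iInter]
      exact Iff.rfl
    rw [h]
    refine isClosed_iInter fun k => isClosed_eq (continuous_coord _) ?_
    exact Complex.continuous_conj.comp (continuous_coord k)
  exact this.completeSpace_coe

lemma phi_neg (k : ℤ) : phiSymb (-k) = - phiSymb k := by
  simp [phiSymb, neg_div]

lemma phi_abs_le (k : ℤ) : |phiSymb k| ≤ 1 := by
  rw [phiSymb, abs_div, abs_of_pos (show (0:ℝ) < 1 + (k:ℝ)^2 by positivity),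
    div_le_one (by positivity)]
  nlinarith [sq_abs (k:ℝ), sq_nonneg (|(k:ℝ)| - 1)]

lemma phi_memlp : Memℓp (fun k : ℤ => (phiSymb k : ℂ)) 2 := by
  refine memℓp_gen ?_
  have hs : Summable fun k : ℤ => 1 / (k:ℝ) ^ 2 := Real.summable_one_div_int_pow.2 (by norm_num)
  refine Summable.of_nonneg_of_le (fun k => by positivity) (fun k => ?_) hs
  rw [ENNReal.toReal_ofNat, Real.rpow_two, Complex.norm_real, Real.norm_eq_abs, sq_abs, phiSymb]
  rcases eq_or_ne k 0 with rfl | hk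
  · simp
  have hk' : (0:ℝ) < (k:ℝ)^2 := by positivity
  rw [div_pow, div_le_div_iff₀ (by positivity) hk']
  nlinarith

/-- The symbol as an `ℓ²` sequence. -/
def phiL : SeqLp := ⟨_, phi_memlp⟩

/-- The generator `-iφ(D)` as a function. -/
def aFun (v : realSub) : realSub :=
  mkR (fun k => -I * phiSymb k * (v : SeqLp) k) v
    (fun k => by
      rw [norm_mul, norm_mul, norm_neg, Complex.norm_I, one_mul, Complex.norm_real]
      exact mul_le_of_le_one_left (norm_nonneg _) (phi_abs_le k))
    (fun k => by
      have := v.2 k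
      simp only [phi_neg, map_mul, map_neg, Complex.conj_I, Complex.conj_ofReal]
      rw [this]; push_cast; ring)

lemma aFun_apply (v : realSub) (k : ℤ) :
    (aFun v : SeqLp) k = -I * phiSymb k * (v : SeqLp) k := rfl

lemma aFun_norm (v : realSub) : ‖aFun v‖ ≤ ‖v‖ := by
  unfold aFun
  exact mkR_norm _ _ _ _

/-- The generator `-iφ(D)`. -/
def genA : realSub →L[ℝ] realSub :=
  LinearMap.mkContinuous
    { toFun := aFun
      map_add' := fun u v => realSub_ext fun k => by
        simp [aFun_apply, mul_add]
      map_smul' := fun c u => realSub_ext fun k => by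
        simp [aFun_apply]; ring } 1 (fun v => by
        rw [one_mul]
        exact aFun_norm v)

lemma genA_apply (v : realSub) (k : ℤ) :
    (genA v : SeqLp) k = -I * phiSymb k * (v : SeqLp) k := rfl

/-- The linear group. -/
def grp (t : ℝ) : realSub →L[ℝ] realSub := expg genA t

lemma grp_cont : Continuous grp := expg_cont genA

lemma grp_apply (t : ℝ) (v : realSub) (k : ℤ) :
    (grp t v : SeqLp) k = Complex.exp (-I * t * phiSymb k) * (v : SeqLp) k := by
  refine (expg_apply genA (evL k) (-I * phiSymb k) (fun v => genA_apply v k) t v).trans ?_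
  rw [evL_apply]
  congr 2
  ring

/-- weight -/
def wt (s : ℝ) (k : ℤ) : ℝ := (1 + (k : ℝ) ^ 2) ^ (-(s / 2))

lemma wt_pos (s : ℝ) (k : ℤ) : 0 < wt s k := by unfold wt; positivity

lemma wt_neg (s : ℝ) (k : ℤ) : wt s (-k) = wt s k := by simp [wt]

lemma coeffAt_eq (s : ℝ) (v : realSub) (k : ℤ) : coeffAt s v k = wt s k * (v : SeqLp) k := rfl

lemma wt_peetre {s : ℝ} (hs : 0 ≤ s) (k l : ℤ) :
    (wt s k)⁻¹ * (wt s l * wt s (k - l)) ≤ 2 ^ (s / 2) := by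
  have h : (1 + (k:ℝ)^2) ≤ 2 * ((1 + (l:ℝ)^2) * (1 + ((k-l : ℤ):ℝ)^2)) := by
    push_cast
    nlinarith [sq_nonneg ((k:ℝ) - 2 * l), sq_nonneg ((l:ℝ) * (k - l))]
  have h2 := Real.rpow_le_rpow (by positivity) h (show 0 ≤ s / 2 by positivity)
  rw [Real.mul_rpow (by positivity) (by positivity),
    Real.mul_rpow (by positivity) (by positivity)] at h2
  unfold wt
  rw [Real.rpow_neg (by positivity), Real.rpow_neg (by positivity), Real.rpow_neg (by positivity),
    inv_inv, ← mul_inv, ← div_eq_mul_inv, div_le_iff₀ (by positivity)]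
  exact h2

lemma conv_l2 (u v : SeqLp) (k : ℤ) : (Summable fun l => ‖u l‖ * ‖v (k - l)‖) ∧
    ∑' l, ‖u l‖ * ‖v (k - l)‖ ≤ ‖u‖ * ‖v‖ := by
  have hu := lp.hasSum_norm two_toReal_pos u
  have hv := lp.hasSum_norm two_toReal_pos v
  have hv' := (Equiv.subLeft k).hasSum_iff.2 hv
  rw [ENNReal.toReal_ofNat] at hu hv'
  obtain ⟨C, hC0, hC, hCs⟩ := Real.inner_le_Lp_mul_Lq_hasSum_of_nonneg Real.HolderConjugate.two_two
    (norm_nonneg u) (norm_nonneg v) (fun i => norm_nonneg (u i)) (fun i => norm_nonneg (v (k - i)))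
    hu hv'
  exact ⟨hCs.summable, hCs.tsum_eq ▸ hC⟩

lemma coeff_prod_norm (s : ℝ) (u v : realSub) (k l : ℤ) :
    ‖coeffAt s u l * coeffAt s v (k - l)‖ =
      (wt s l * wt s (k - l)) * (‖(u : SeqLp) l‖ * ‖(v : SeqLp) (k - l)‖) := by
  rw [coeffAt_eq, coeffAt_eq, norm_mul, norm_mul, norm_mul, Complex.norm_real, Complex.norm_real,
    Real.norm_of_nonneg (wt_pos _ _).le, Real.norm_of_nonneg (wt_pos _ _).le]
  ring

lemma coeff_prod_le {s : ℝ} (hs : 0 ≤ s) (u v : realSub) (k l : ℤ) :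
    ‖coeffAt s u l * coeffAt s v (k - l)‖ ≤
      (wt s k * 2 ^ (s / 2)) * (‖(u : SeqLp) l‖ * ‖(v : SeqLp) (k - l)‖) := by
  rw [coeff_prod_norm]
  have := wt_peetre hs k l
  rw [inv_mul_le_iff₀ (wt_pos s k)] at this
  exact mul_le_mul_of_nonneg_right this (by positivity)

lemma conv_summable {s : ℝ} (hs : 0 ≤ s) (u v : realSub) (k : ℤ) :
    Summable fun l => coeffAt s u l * coeffAt s v (k - l) :=
  Summable.of_norm_bounded ((conv_l2 (u : SeqLp) v k).1.mul_left _) (coeff_prod_le hs u v k)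

lemma conv_bound {s : ℝ} (hs : 0 ≤ s) (u v : realSub) (k : ℤ) :
    ‖∑' l, coeffAt s u l * coeffAt s v (k - l)‖ ≤ (wt s k * 2 ^ (s / 2)) * (‖u‖ * ‖v‖) := by
  have h := conv_l2 (u : SeqLp) v k
  refine (tsum_of_norm_bounded (h.1.mul_left _).hasSum (coeff_prod_le hs u v k)).trans ?_
  rw [tsum_mul_left]
  have := wt_pos s k
  gcongr
  exact h.2

lemma coeffAt_neg (s : ℝ) (u : realSub) (k : ℤ) : coeffAt s u (-k) = conj (coeffAt s u k) := by
  rw [coeffAt_eq, coeffAt_eq, wt_neg, map_mul, Complex.conj_ofReal]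
  congr 1
  exact u.2 k

lemma conv_neg (s : ℝ) (u v : realSub) (k : ℤ) :
    ∑' l, coeffAt s u l * coeffAt s v (-k - l) =
      conj (∑' l, coeffAt s u l * coeffAt s v (k - l)) := by
  rw [Complex.conj_tsum, ← (Equiv.neg ℤ).tsum_eq]
  refine tsum_congr fun l => ?_
  rw [Equiv.neg_apply, map_mul, ← coeffAt_neg, ← coeffAt_neg]
  congr 2
  ring

/-- Sequence for the bilinear form. -/
def bSeq (s : ℝ) (u v : realSub) (k : ℤ) : ℂ :=
  ((wt s k : ℝ) : ℂ)⁻¹ * (-(I / 2) * phiSymb k * ∑' l, coeffAt s u l * coeffAt s v (k - l))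

lemma bSeq_le {s : ℝ} (hs : 0 ≤ s) (u v : realSub) (k : ℤ) :
    ‖bSeq s u v k‖ ≤ ‖(((2:ℝ) ^ (s / 2) * ‖u‖ * ‖v‖) • phiL : SeqLp) k‖ := by
  have e : (((2:ℝ) ^ (s / 2) * ‖u‖ * ‖v‖) • phiL : SeqLp) k
    = (((2:ℝ) ^ (s / 2) * ‖u‖ * ‖v‖ : ℝ) : ℂ) * (phiSymb k : ℂ) := by
    rw [lp.coeFn_smul, Pi.smul_apply, Complex.real_smul]; rfl
  rw [e, bSeq]
  have hw := wt_pos s k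
  have hI : ‖-(I / 2)‖ ≤ 1 := by
    rw [norm_neg, norm_div, Complex.norm_I]; norm_num
  rw [norm_mul, norm_mul, norm_mul, norm_mul, norm_inv, Complex.norm_real, Complex.norm_real,
    Complex.norm_real, Real.norm_of_nonneg hw.le,
    Real.norm_of_nonneg (show 0 ≤ (2:ℝ) ^ (s / 2) * ‖u‖ * ‖v‖ by positivity)]
  calc _ ≤ (wt s k)⁻¹ * (1 * ‖phiSymb k‖ * ((wt s k * 2 ^ (s / 2)) * (‖u‖ * ‖v‖))) := by
        gcongr
        exact conv_bound hs u v k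
    _ = _ := by field_simp

lemma bSeq_neg (s : ℝ) (u v : realSub) (k : ℤ) : bSeq s u v (-k) = conj (bSeq s u v k) := by
  simp only [bSeq, wt_neg, phi_neg, conv_neg, map_mul, map_inv₀, map_neg, map_div₀,
    Complex.conj_I, Complex.conj_ofReal, map_ofNat]
  push_cast
  ring

lemma coeffAt_add (s : ℝ) (u v : realSub) (k : ℤ) :
    coeffAt s (u + v) k = coeffAt s u k + coeffAt s v k := by
  simp [coeffAt, mul_add]

lemma coeffAt_smul (s c : ℝ) (u : realSub) (k : ℤ) :
    coeffAt s (c • u) k = c * coeffAt s u k := by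
  simp [coeffAt]; ring

lemma bSeq_comm (s : ℝ) (u v : realSub) (k : ℤ) : bSeq s u v k = bSeq s v u k := by
  unfold bSeq
  congr 2
  rw [← (Equiv.subLeft k).tsum_eq]
  refine tsum_congr fun l => ?_
  simp [mul_comm]

lemma bSeq_add {s : ℝ} (hs : 0 ≤ s) (u u' v : realSub) (k : ℤ) :
    bSeq s (u + u') v k = bSeq s u v k + bSeq s u' v k := by
  simp only [bSeq, coeffAt_add, add_mul]
  rw [(conv_summable hs u v k).tsum_add (conv_summable hs u' v k)]
  ring

lemma bSeq_smul (s c : ℝ) (u v : realSub) (k : ℤ) :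
    bSeq s (c • u) v k = c * bSeq s u v k := by
  simp only [bSeq, coeffAt_smul, mul_assoc, tsum_mul_left]
  ring

/-- The bilinear term as an element of `realSub`. -/
def bFun {s : ℝ} (hs : 0 ≤ s) (u v : realSub) : realSub :=
  mkR (bSeq s u v) _ (bSeq_le hs u v) (bSeq_neg s u v)

lemma bFun_apply {s : ℝ} (hs : 0 ≤ s) (u v : realSub) (k : ℤ) :
    (bFun hs u v : SeqLp) k = bSeq s u v k := rfl

/-- The bilinear operator. -/
def bL {s : ℝ} (hs : 0 ≤ s) : realSub →L[ℝ] realSub →L[ℝ] realSub :=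
  LinearMap.mkContinuous₂ (LinearMap.mk₂ ℝ (bFun hs)
    (fun u u' v => realSub_ext fun k => by
      simp [bFun_apply, bSeq_add hs])
    (fun c u v => realSub_ext fun k => by
      simp [bFun_apply, bSeq_smul])
    (fun u v v' => realSub_ext fun k => by
      simp [bFun_apply, bSeq_comm s u, bSeq_add hs])
    (fun c u v => realSub_ext fun k => by
      simp [bFun_apply, bSeq_comm s u, bSeq_smul]))
    (2 ^ (s / 2) * ‖phiL‖) (fun u v => by
      refine (mkR_norm _ _ (bSeq_le hs u v) (bSeq_neg s u v)).trans ?_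
      rw [norm_smul, Real.norm_of_nonneg (by positivity)]
      apply le_of_eq; ring)

lemma bL_apply {s : ℝ} (hs : 0 ≤ s) (u v : realSub) (k : ℤ) :
    (bL hs u v : SeqLp) k = bSeq s u v k := rfl

end Concrete

/-- Real-analyticity of the local flow map: if `s ≥ 0`, `R > 0` and `T`
is a uniform local existence time for BBM for all initial data in `B_R(H^s(𝕋))` (i.e. the
flow map `Φ : u₀ ↦ u` sends each `u₀ ∈ B_R` to a solution `Φ u₀ ∈ X^s_T` of the BBM
integral equation), then `Φ` is real-analytic from `B_R(H^s(𝕋))` to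
`X^s_T = C⁰([-T,T], H^s(𝕋))`. -/
theorem flowMap_analyticOn_ball
    (s R T : ℝ) (hs : 0 ≤ s) (hR : 0 < R) (hT : 0 < T)
    (Φ : realSub → C(Set.Icc (-T) T, realSub))
    (hΦ : ∀ u₀ ∈ Metric.ball (0 : realSub) R, IsBBMSol s T u₀ (Φ u₀)) :
    AnalyticOnNhd ℝ Φ (Metric.ball (0 : realSub) R) := by
  have hT' : -T ≤ T := by linarith
  refine abstract_analytic hT' grp grp_cont (bL hs)
    (fun x y => realSub_ext fun k => by rw [bL_apply, bL_apply, bSeq_comm]) Φ _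
    Metric.isOpen_ball ?_
  intro u hu t
  obtain ⟨t, ht⟩ := t
  refine realSub_ext fun k => ?_
  have hw : ((wt s k : ℝ) : ℂ) ≠ 0 := by exact_mod_cast (wt_pos s k).ne'
  apply mul_left_cancel₀ hw
  have h := hΦ u hu t ht k
  have e1 : uc s T (Φ u) t k = wt s k * (Φ u ⟨t, ht⟩ : SeqLp) k := by
    rw [uc, dif_pos ht, coeffAt_eq]
  rw [← e1, h]
  have e2 : ((grp t u + volt hT' grp grp_cont (bL hs) (Φ u) (Φ u) ⟨t, ht⟩ : realSub) : SeqLp) k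
      = (grp t u : SeqLp) k +
        evL k (volt hT' grp grp_cont (bL hs) (Φ u) (Φ u) ⟨t, ht⟩) := by
    simp [evL_apply]
  rw [e2, grp_apply]
  simp only [volt, ContinuousMap.coe_mk]
  rw [← ContinuousLinearMap.intervalIntegral_comp_comm _
    ((volt_cont hT' grp grp_cont (bL hs) (Φ u) (Φ u) t).intervalIntegrable 0 t),
    mul_add, coeffAt_eq, sub_eq_add_neg]
  congr 1
  · ring
  rw [← neg_mul, ← intervalIntegral.integral_const_mul, ← intervalIntegral.integral_const_mul]
  refine intervalIntegral.integral_congr fun τ hτ => ?_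
  have hτ' : τ ∈ Set.Icc (-T) T :=
    Set.uIcc_subset_Icc ⟨by linarith, by linarith⟩ ht hτ
  simp only [evL_apply]
  rw [grp_apply, bL_apply, bSeq, Set.projIcc_of_mem hT' hτ']
  simp only [uc, dif_pos hτ']
  push_cast
  field_simp

end BBMFlow
end
end

section
/- Let Φ_t be the global flow of the BBM equation on H^{1/2}(T) and write Φ_t = e^{−itφ(D)}(I + Φ̃_t), so Φ̃_t is the nonlinear part of the flow. For every 0 < ε < 1/12 and every R, T > 0 there exists a constant C_{R,T,ε} such that for all u₀, v₀ ∈ B_R(H^{1/2}(T)), sup_{|t|≤T} ‖Φ̃_t(u₀) − Φ̃_t(v₀)‖_{H^{1/2+ε}(T)} ≤ C_{R,T,ε} ‖u₀ − v₀‖_{H^{1/2−ε}(T)}. -/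
open scoped BigOperators ComplexConjugate
open Complex

noncomputable section

namespace BBM

/-- `Φ` is the global flow map of the BBM equation on (real-valued) `H^s(𝕋)`. -/
def IsGlobalFlow (s : ℝ) (Φ : ℝ → (ℤ → ℂ) → ℤ → ℂ) : Prop :=
  ∀ u₀ : ℤ → ℂ, IsRealSeq u₀ → MemHs s u₀ →
    Φ 0 u₀ = u₀ ∧ (∀ t : ℝ, MemHs s (Φ t u₀) ∧ IsRealSeq (Φ t u₀)) ∧
    (∀ T : ℝ, 0 < T → ContHs s T fun t => Φ t u₀) ∧
    (∀ t : ℝ, SolvesBBM u₀ (fun τ => Φ τ u₀) t)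

/-- The nonlinear part `Φ̃_t` of the BBM flow, defined by `Φ_t = e^{-itφ(D)} (I + Φ̃_t)`,
i.e. `Φ̃_t(u₀) = e^{itφ(D)} Φ_t(u₀) - u₀`. -/
def nonlinPart (Φ : ℝ → (ℤ → ℂ) → ℤ → ℂ) (t : ℝ) (u₀ : ℤ → ℂ) : ℤ → ℂ :=
  fun k => Complex.exp (Complex.I * t * phiSymb k) * Φ t u₀ k - u₀ k

lemma wt_add (a b : ℝ) (k : ℤ) : wt (a + b) k = wt a k * wt b k := by
  unfold wt; exact Real.rpow_add (by positivity) a b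

lemma wt_mono {a b : ℝ} (h : a ≤ b) (k : ℤ) : wt a k ≤ wt b k := by
  unfold wt
  exact Real.rpow_le_rpow_of_exponent_le (by nlinarith [sq_nonneg (k:ℝ)]) h

lemma wt_zero (k : ℤ) : wt 0 k = 1 := by simp [wt]

lemma summable_wt {a : ℝ} (ha : 1 < 2 * a) : Summable (fun k : ℤ => wt (-a) k) := by
  have h := Real.summable_abs_int_rpow ha
  refine Summable.of_norm_bounded_eventually h ?_
  have : ({0} : Set ℤ)ᶜ ∈ Filter.cofinite := (Set.finite_singleton (0:ℤ)).compl_mem_cofinite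
  filter_upwards [this] with k hk
  have hk0 : (k : ℝ) ≠ 0 := by exact_mod_cast hk
  rw [Real.norm_of_nonneg (wt_pos _ _).le]
  unfold wt
  have e : |(k:ℝ)| ^ (-(2*a)) = ((k:ℝ)^2) ^ (-a) := by
    rw [← sq_abs, ← Real.rpow_natCast, ← Real.rpow_mul (abs_nonneg _)]
    congr 1; push_cast; ring
  rw [e]
  exact Real.rpow_le_rpow_of_nonpos (by positivity) (by linarith) (by linarith)

/-- squared norm -/
def Q (s : ℝ) (u : ℤ → ℂ) : ℝ := ∑' k : ℤ, wt s k * ‖u k‖ ^ 2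

lemma term_nonneg (s : ℝ) (u : ℤ → ℂ) (k : ℤ) : 0 ≤ wt s k * ‖u k‖ ^ 2 :=
  mul_nonneg (wt_pos s k).le (by positivity)

lemma Q_nonneg (s : ℝ) (u : ℤ → ℂ) : 0 ≤ Q s u := tsum_nonneg (term_nonneg s u)

lemma hsNorm_sq (s : ℝ) (u : ℤ → ℂ) : hsNorm s u ^ 2 = Q s u := Real.sq_sqrt (Q_nonneg s u)

lemma hsNorm_nonneg (s : ℝ) (u : ℤ → ℂ) : 0 ≤ hsNorm s u := Real.sqrt_nonneg _

lemma MemHs.mono {a b : ℝ} (h : a ≤ b) {u : ℤ → ℂ} (hu : MemHs b u) : MemHs a u :=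
  Summable.of_nonneg_of_le (term_nonneg a u)
    (fun k => mul_le_mul_of_nonneg_right (wt_mono h k) (by positivity)) hu

lemma Q_mono {a b : ℝ} (h : a ≤ b) {u : ℤ → ℂ} (hu : MemHs b u) : Q a u ≤ Q b u :=
  Summable.tsum_le_tsum
    (fun k => mul_le_mul_of_nonneg_right (wt_mono h k) (by positivity)) (hu.mono h) hu

lemma memHs_of_le {s : ℝ} {u : ℤ → ℂ} {c : ℝ}
    (h : ∀ S : Finset ℤ, ∑ k ∈ S, wt s k * ‖u k‖ ^ 2 ≤ c) : MemHs s u ∧ Q s u ≤ c :=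
  ⟨summable_of_sum_le (term_nonneg s u) h, Real.tsum_le_of_sum_le (term_nonneg s u) h⟩

lemma norm_add_sq_le2 (a b : ℂ) : ‖a + b‖ ^ 2 ≤ 2 * ‖a‖ ^ 2 + 2 * ‖b‖ ^ 2 := by
  have := norm_add_le a b
  nlinarith [sq_nonneg (‖a‖ - ‖b‖), norm_nonneg (a+b), norm_nonneg a, norm_nonneg b]

lemma MemHs_add {s : ℝ} {u v : ℤ → ℂ} (hu : MemHs s u) (hv : MemHs s v) :
    MemHs s (fun k => u k + v k) ∧ Q s (fun k => u k + v k) ≤ 2 * Q s u + 2 * Q s v := by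
  have h : ∀ k, wt s k * ‖u k + v k‖ ^ 2 ≤
      2 * (wt s k * ‖u k‖ ^ 2) + 2 * (wt s k * ‖v k‖ ^ 2) := by
    intro k
    nlinarith [mul_le_mul_of_nonneg_left (norm_add_sq_le2 (u k) (v k)) (wt_pos s k).le]
  have hs := (hu.mul_left 2).add (hv.mul_left 2)
  have h1 : MemHs s (fun k => u k + v k) := Summable.of_nonneg_of_le (term_nonneg s _) h hs
  refine ⟨h1, ?_⟩
  unfold Q
  rw [← tsum_mul_left, ← tsum_mul_left, ← (hu.mul_left 2).tsum_add (hv.mul_left 2)]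
  exact h1.tsum_le_tsum h hs

lemma Q_congr {s : ℝ} {u v : ℤ → ℂ} (h : ∀ k, ‖u k‖ = ‖v k‖) :
    (MemHs s u ↔ MemHs s v) ∧ Q s u = Q s v := by
  unfold MemHs Q; simp only [h, true_and, iff_self]

lemma MemHs_smul {s : ℝ} {u : ℤ → ℂ} (c : ℂ) (hu : MemHs s u) :
    MemHs s (fun k => c * u k) ∧ Q s (fun k => c * u k) = ‖c‖ ^ 2 * Q s u := by
  have h : ∀ k, wt s k * ‖c * u k‖ ^ 2 = ‖c‖ ^ 2 * (wt s k * ‖u k‖ ^ 2) := by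
    intro k; rw [norm_mul]; ring
  unfold MemHs Q; simp only [h]
  exact ⟨Summable.mul_left _ hu, tsum_mul_left⟩

lemma MemHs_sub {s : ℝ} {u v : ℤ → ℂ} (hu : MemHs s u) (hv : MemHs s v) :
    MemHs s (fun k => u k - v k) ∧ Q s (fun k => u k - v k) ≤ 2 * Q s u + 2 * Q s v := by
  have hn := MemHs_smul (-1) hv
  have := MemHs_add hu hn.1
  rw [hn.2] at this
  simpa [sub_eq_add_neg] using this

lemma cs_tsum {ι : Type*} {a b : ι → ℝ} (ha : ∀ i, 0 ≤ a i) (hb : ∀ i, 0 ≤ b i)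
    (hA : Summable fun i => a i ^ 2) (hB : Summable fun i => b i ^ 2) :
    Summable (fun i => a i * b i) ∧
      (∑' i, a i * b i) ^ 2 ≤ (∑' i, a i ^ 2) * (∑' i, b i ^ 2) := by
  have hs : Summable (fun i => a i * b i) := by
    refine Summable.of_nonneg_of_le (fun i => mul_nonneg (ha i) (hb i)) (fun i => ?_) (hA.add hB)
    nlinarith [sq_nonneg (a i - b i), mul_nonneg (ha i) (hb i)]
  refine ⟨hs, ?_⟩
  have hP : 0 ≤ (∑' i, a i ^ 2) * (∑' i, b i ^ 2) :=
    mul_nonneg (tsum_nonneg fun i => sq_nonneg _) (tsum_nonneg fun i => sq_nonneg _)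
  have : ∑' i, a i * b i ≤ Real.sqrt ((∑' i, a i ^ 2) * (∑' i, b i ^ 2)) := by
    refine hs.tsum_le_of_sum_le fun S => ?_
    refine Real.le_sqrt_of_sq_le ?_
    refine (Finset.sum_mul_sq_le_sq_mul_sq S a b).trans ?_
    exact mul_le_mul (hA.sum_le_tsum S fun i _ => sq_nonneg _)
      (hB.sum_le_tsum S fun i _ => sq_nonneg _) (Finset.sum_nonneg fun i _ => sq_nonneg _)
      (tsum_nonneg fun i => sq_nonneg _)
  calc _ ≤ (Real.sqrt ((∑' i, a i ^ 2) * (∑' i, b i ^ 2))) ^ 2 :=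
        pow_le_pow_left₀ (tsum_nonneg fun i => mul_nonneg (ha i) (hb i)) this 2
    _ = _ := Real.sq_sqrt hP

lemma hsNorm_add_le {s : ℝ} {u v : ℤ → ℂ} (hu : MemHs s u) (hv : MemHs s v) :
    hsNorm s (fun k => u k + v k) ≤ hsNorm s u + hsNorm s v := by
  have key : Q s (fun k => u k + v k) ≤ (hsNorm s u + hsNorm s v) ^ 2 := by
    have hsq : ∀ (z : ℤ → ℂ) k, (Real.sqrt (wt s k) * ‖z k‖) ^ 2 = wt s k * ‖z k‖ ^ 2 := by
      intro z k; rw [mul_pow, Real.sq_sqrt (wt_pos s k).le]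
    obtain ⟨h1, h2⟩ := cs_tsum (a := fun k => Real.sqrt (wt s k) * ‖u k‖)
      (b := fun k => Real.sqrt (wt s k) * ‖v k‖) (fun k => by positivity) (fun k => by positivity)
      (by simp only [hsq]; exact hu) (by simp only [hsq]; exact hv)
    simp only [hsq] at h2
    have h3 : ∑' k, (Real.sqrt (wt s k) * ‖u k‖) * (Real.sqrt (wt s k) * ‖v k‖) ≤
        hsNorm s u * hsNorm s v := by
      refine abs_le_of_sq_le_sq' ?_ (mul_nonneg (hsNorm_nonneg _ _) (hsNorm_nonneg _ _)) |>.2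
      rw [mul_pow, hsNorm_sq, hsNorm_sq]; exact h2
    have h4 : Q s (fun k => u k + v k) ≤ Q s u + 2 *
        (∑' k, (Real.sqrt (wt s k) * ‖u k‖) * (Real.sqrt (wt s k) * ‖v k‖)) + Q s v := by
      unfold Q
      rw [← tsum_mul_left, ← Summable.tsum_add hu (h1.mul_left 2),
        ← Summable.tsum_add (hu.add (h1.mul_left 2)) hv]
      refine (MemHs_add hu hv).1.tsum_le_tsum (fun k => ?_) ((hu.add (h1.mul_left 2)).add hv)
      have e : Real.sqrt (wt s k) * ‖u k‖ * (Real.sqrt (wt s k) * ‖v k‖)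
          = wt s k * (‖u k‖ * ‖v k‖) := by
        nth_rewrite 3 [← Real.sq_sqrt (wt_pos s k).le]; ring
      rw [e]
      have := pow_le_pow_left₀ (norm_nonneg _) (norm_add_le (u k) (v k)) 2
      nlinarith [mul_le_mul_of_nonneg_left this (wt_pos s k).le]
    rw [add_sq, hsNorm_sq, hsNorm_sq]; linarith
  unfold hsNorm at *
  exact Real.sqrt_le_iff.2 ⟨by positivity, key⟩

lemma hsNorm_sub_comm (s : ℝ) (u v : ℤ → ℂ) :
    hsNorm s (fun k => u k - v k) = hsNorm s (fun k => v k - u k) := by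
  unfold hsNorm; simp only [norm_sub_rev]

/-- bilinear estimate -/
lemma bilin_summable {s : ℝ} (hs : 0 ≤ s) {f g : ℤ → ℂ} (hf : MemHs s f) (hg : MemHs s g) (k : ℤ) :
    Summable (fun l => f l * g (k - l)) := by
  have hf0 := hf.mono hs
  have hg0 := hg.mono hs
  simp only [MemHs, wt_zero, one_mul] at hf0 hg0
  have hg1 : Summable fun l => ‖g (k - l)‖ ^ 2 :=
    (Equiv.subLeft k).summable_iff.2 hg0
  have := (cs_tsum (a := fun l => ‖f l‖) (b := fun l => ‖g (k - l)‖)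
    (fun _ => norm_nonneg _) (fun _ => norm_nonneg _) hf0 hg1).1
  refine Summable.of_norm ?_
  simpa only [norm_mul] using this

lemma bilin_pt {s : ℝ} (hs : 0 ≤ s) {f g : ℤ → ℂ} (hf : MemHs s f) (hg : MemHs s g) (k : ℤ) :
    Summable (fun l => ‖f l‖ ^ 2 * wt (-s) (k - l)) ∧
    ‖prodHat f g k‖ ^ 2 ≤ (∑' l, ‖f l‖ ^ 2 * wt (-s) (k - l)) * Q s g := by
  have hf0 := hf.mono hs
  simp only [MemHs, wt_zero, one_mul] at hf0
  have h1 : Summable (fun l => ‖f l‖ ^ 2 * wt (-s) (k - l)) := by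
    refine Summable.of_nonneg_of_le (fun l => mul_nonneg (by positivity) (wt_pos _ _).le)
      (fun l => ?_) hf0
    have := wt_mono (show -s ≤ 0 by linarith) (k - l)
    rw [wt_zero] at this
    exact mul_le_of_le_one_right (by positivity) this
  refine ⟨h1, ?_⟩
  have e1 : ∀ l, (‖f l‖ * Real.sqrt (wt (-s) (k - l))) ^ 2 = ‖f l‖ ^ 2 * wt (-s) (k - l) := by
    intro l; rw [mul_pow, Real.sq_sqrt (wt_pos _ _).le]
  have e2 : ∀ l, (Real.sqrt (wt s (k - l)) * ‖g (k - l)‖) ^ 2 = wt s (k - l) * ‖g (k - l)‖ ^ 2 := by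
    intro l; rw [mul_pow, Real.sq_sqrt (wt_pos _ _).le]
  have e3 : ∀ l, (‖f l‖ * Real.sqrt (wt (-s) (k - l))) * (Real.sqrt (wt s (k - l)) * ‖g (k - l)‖)
      = ‖f l * g (k - l)‖ := by
    intro l
    have : Real.sqrt (wt (-s) (k - l)) * Real.sqrt (wt s (k - l)) = 1 := by
      rw [← Real.sqrt_mul (wt_pos _ _).le, ← wt_add, neg_add_cancel, wt_zero, Real.sqrt_one]
    rw [norm_mul]
    calc _ = ‖f l‖ * ‖g (k-l)‖ * (Real.sqrt (wt (-s) (k - l)) * Real.sqrt (wt s (k - l))) := by ring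
      _ = _ := by rw [this, mul_one]
  have hgs : Summable (fun l => wt s (k - l) * ‖g (k - l)‖ ^ 2) :=
    (Equiv.subLeft k).summable_iff (f := fun l => wt s l * ‖g l‖ ^ 2) |>.2 hg
  have hgt : ∑' l, wt s (k - l) * ‖g (k - l)‖ ^ 2 = Q s g :=
    (Equiv.subLeft k).tsum_eq (fun l => wt s l * ‖g l‖ ^ 2)
  obtain ⟨h2, h3⟩ := cs_tsum (a := fun l => ‖f l‖ * Real.sqrt (wt (-s) (k - l)))
    (b := fun l => Real.sqrt (wt s (k - l)) * ‖g (k - l)‖)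
    (fun _ => by positivity) (fun _ => by positivity)
    (by simpa only [e1] using h1) (by simpa only [e2] using hgs)
  simp only [e1, e2, e3, hgt] at h2 h3
  refine le_trans ?_ h3
  exact pow_le_pow_left₀ (norm_nonneg _) (norm_tsum_le_tsum_norm h2) 2

lemma bilin {s : ℝ} (hs : 1 < 4 * s) {f g : ℤ → ℂ} (hf : MemHs s f) (hg : MemHs s g)
    (S : Finset ℤ) :
    ∑ k ∈ S, wt (1 - s) k * (phiSymb k ^ 2 * ‖prodHat f g k‖ ^ 2) ≤
      (∑' k, wt (-(2 * s)) k) * (Q s f * Q s g) := by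
  have hs0 : 0 ≤ s := by linarith
  have hM : Summable (fun k => wt (-(2 * s)) k) := summable_wt (by linarith)
  set M := ∑' k, wt (-(2 * s)) k with hMdef
  have hf0 := hf.mono hs0
  have hQ0 : ∑' l, ‖f l‖ ^ 2 ≤ Q s f := by
    have := Q_mono hs0 hf
    simpa only [Q, wt_zero, one_mul] using this
  simp only [MemHs, wt_zero, one_mul] at hf0
  have hphi : ∀ k, wt (1 - s) k * phiSymb k ^ 2 ≤ wt (-s) k := by
    intro k
    have e : wt (1 - s) k = wt (-s) k * (1 + (k:ℝ)^2) := by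
      rw [show 1 - s = -s + 1 by ring, wt_add]; simp [wt]
    rw [e, mul_assoc]
    refine mul_le_of_le_one_right (wt_pos _ _).le ?_
    unfold phiSymb
    rw [div_pow, mul_div_assoc', div_le_one (by positivity)]
    nlinarith [sq_nonneg (k:ℝ)]
  have hM0 : 0 ≤ M := tsum_nonneg fun k => (wt_pos _ k).le
  have hw : ∀ l, ∑ k ∈ S, wt (-s) k * wt (-s) (k - l) ≤ M := by
    intro l
    have hsq : ∀ k, wt (-(2*s)) k = wt (-s) k * wt (-s) k := by
      intro k; rw [← wt_add]; ring_nf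
    have h1 : ∑ k ∈ S, wt (-(2*s)) k ≤ M := hM.sum_le_tsum S fun k _ => (wt_pos _ k).le
    have h2 : ∑ k ∈ S, wt (-(2*s)) (k - l) ≤ M := by
      have hM' : Summable (fun k => wt (-(2*s)) (k - l)) :=
        (Equiv.subRight l).summable_iff (f := fun k => wt (-(2*s)) k) |>.2 hM
      have := hM'.sum_le_tsum S fun k _ => (wt_pos _ (k - l)).le
      exact this.trans ((Equiv.subRight l).tsum_eq (fun k => wt (-(2*s)) k)).le
    have h3 : ∑ k ∈ S, wt (-s) k * wt (-s) (k - l) ≤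
        ∑ k ∈ S, (wt (-(2*s)) k + wt (-(2*s)) (k - l)) / 2 := by
      refine Finset.sum_le_sum fun k _ => ?_
      rw [hsq, hsq]; nlinarith [sq_nonneg (wt (-s) k - wt (-s) (k - l))]
    rw [← Finset.sum_div, Finset.sum_add_distrib] at h3
    linarith
  have hg0 := Q_nonneg s g
  calc ∑ k ∈ S, wt (1 - s) k * (phiSymb k ^ 2 * ‖prodHat f g k‖ ^ 2)
      ≤ ∑ k ∈ S, wt (-s) k * ((∑' l, ‖f l‖ ^ 2 * wt (-s) (k - l)) * Q s g) := by
        refine Finset.sum_le_sum fun k _ => ?_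
        rw [← mul_assoc]
        exact mul_le_mul (hphi k) (bilin_pt hs0 hf hg k).2 (by positivity) (wt_pos _ _).le
    _ = (∑ k ∈ S, ∑' l, wt (-s) k * (‖f l‖ ^ 2 * wt (-s) (k - l))) * Q s g := by
        rw [Finset.sum_mul]
        refine Finset.sum_congr rfl fun k _ => ?_
        rw [tsum_mul_left]; ring
    _ = (∑' l, ∑ k ∈ S, wt (-s) k * (‖f l‖ ^ 2 * wt (-s) (k - l))) * Q s g := by
        rw [Summable.tsum_finsetSum fun k _ => (bilin_pt hs0 hf hg k).1.mul_left _]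
    _ ≤ (M * ∑' l, ‖f l‖ ^ 2) * Q s g := by
        refine mul_le_mul_of_nonneg_right ?_ hg0
        rw [← tsum_mul_left]
        refine Summable.tsum_le_tsum (fun l => ?_)
          (summable_sum fun k _ => (bilin_pt hs0 hf hg k).1.mul_left _) (hf0.mul_left M)
        have : ∑ k ∈ S, wt (-s) k * (‖f l‖ ^ 2 * wt (-s) (k - l)) =
            (∑ k ∈ S, wt (-s) k * wt (-s) (k - l)) * ‖f l‖ ^ 2 := by
          rw [Finset.sum_mul]; exact Finset.sum_congr rfl fun k _ => by ring
        rw [this]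
        exact mul_le_mul_of_nonneg_right (hw l) (by positivity)
    _ ≤ (M * Q s f) * Q s g := by gcongr
    _ = _ := by ring

lemma prodHat_diff {s : ℝ} (hs : 0 ≤ s) {u v : ℤ → ℂ} (hu : MemHs s u) (hv : MemHs s v) (k : ℤ) :
    prodHat u u k - prodHat v v k =
      prodHat (fun k => u k + v k) (fun k => u k - v k) k := by
  have huu := bilin_summable hs hu hu k
  have huv := bilin_summable hs hu hv k
  have hvu := bilin_summable hs hv hu k
  have hvv := bilin_summable hs hv hv k
  have hc : ∑' l, u l * v (k - l) = ∑' l, v l * u (k - l) := by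
    rw [← (Equiv.subLeft k).tsum_eq (fun l => u l * v (k - l))]
    refine tsum_congr fun l => ?_
    simp [mul_comm]
  unfold prodHat
  have : ∀ l, (u l + v l) * (u (k - l) - v (k - l)) =
    (u l * u (k - l) + v l * u (k - l)) - (u l * v (k - l) + v l * v (k - l)) := by intro l; ring
  simp only [this]
  rw [(huu.add hvu).tsum_sub (huv.add hvv), huu.tsum_add hvu, huv.tsum_add hvv, hc]
  ring

lemma prodHat_norm_le {s : ℝ} (hs : 0 ≤ s) {f g : ℤ → ℂ} (hf : MemHs s f) (hg : MemHs s g) (k : ℤ) :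
    ‖prodHat f g k‖ ≤ hsNorm s f * hsNorm s g := by
  refine abs_le_of_sq_le_sq' ?_ (mul_nonneg (hsNorm_nonneg _ _) (hsNorm_nonneg _ _)) |>.2
  rw [mul_pow, hsNorm_sq, hsNorm_sq]
  refine (bilin_pt hs hf hg k).2.trans (mul_le_mul_of_nonneg_right ?_ (Q_nonneg _ _))
  refine Summable.tsum_le_tsum (fun l => ?_) (bilin_pt hs hf hg k).1 hf
  rw [mul_comm]
  refine mul_le_mul_of_nonneg_right ?_ (by positivity)
  have h1 := wt_mono (show -s ≤ 0 by linarith) (k - l)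
  have h2 := wt_mono hs l
  rw [wt_zero] at h1 h2
  linarith

/-- continuity in time in `H^s` -/
def HC (s : ℝ) (u : ℝ → ℤ → ℂ) : Prop :=
  (∀ t, MemHs s (u t)) ∧
  ∀ t₀, Filter.Tendsto (fun t => hsNorm s (fun k => u t k - u t₀ k)) (nhds t₀) (nhds 0)

lemma hsNorm_abs_sub {s : ℝ} {u v : ℤ → ℂ} (hu : MemHs s u) (hv : MemHs s v) :
    |hsNorm s u - hsNorm s v| ≤ hsNorm s (fun k => u k - v k) := by
  have h1 := hsNorm_add_le hv (MemHs_sub hu hv).1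
  have h2 := hsNorm_add_le hu (MemHs_sub hv hu).1
  simp only [add_sub_cancel] at h1 h2
  rw [hsNorm_sub_comm s v u] at h2
  exact abs_le.2 ⟨by linarith, by linarith⟩

lemma HC.cont {s : ℝ} {u : ℝ → ℤ → ℂ} (h : HC s u) : Continuous fun t => hsNorm s (u t) := by
  rw [continuous_iff_continuousAt]
  intro t₀
  rw [ContinuousAt, tendsto_iff_norm_sub_tendsto_zero]
  exact squeeze_zero (fun _ => norm_nonneg _) (fun t => hsNorm_abs_sub (h.1 t) (h.1 t₀)) (h.2 t₀)

lemma HC.contQ {s : ℝ} {u : ℝ → ℤ → ℂ} (h : HC s u) : Continuous fun t => Q s (u t) := by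
  simp only [← hsNorm_sq]; exact h.cont.pow 2

lemma HC.neg {s : ℝ} {u : ℝ → ℤ → ℂ} (h : HC s u) : HC s fun t k => - u t k := by
  refine ⟨fun t => ((Q_congr fun k => norm_neg (u t k)).1).2 (h.1 t), fun t₀ => ?_⟩
  have : (fun t => hsNorm s (fun k => - u t k - - u t₀ k)) =
      (fun t => hsNorm s (fun k => u t k - u t₀ k)) := by
    funext t; rw [hsNorm_sub_comm s (u t)]; congr 1; funext k; ring
  rw [this]; exact h.2 t₀

lemma HC.add {s : ℝ} {u v : ℝ → ℤ → ℂ} (hu : HC s u) (hv : HC s v) :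
    HC s fun t k => u t k + v t k := by
  refine ⟨fun t => (MemHs_add (hu.1 t) (hv.1 t)).1, fun t₀ => ?_⟩
  refine squeeze_zero (fun _ => hsNorm_nonneg _ _) (fun t => ?_)
    (by simpa using (hu.2 t₀).add (hv.2 t₀))
  have := hsNorm_add_le (MemHs_sub (hu.1 t) (hu.1 t₀)).1 (MemHs_sub (hv.1 t) (hv.1 t₀)).1
  convert this using 3; ring

lemma HC.sub {s : ℝ} {u v : ℝ → ℤ → ℂ} (hu : HC s u) (hv : HC s v) :
    HC s fun t k => u t k - v t k := by
  simpa only [sub_eq_add_neg] using hu.add hv.neg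

lemma HC.prod {s : ℝ} (hs : 0 ≤ s) {u : ℝ → ℤ → ℂ} (hu : HC s u) (k : ℤ) :
    Continuous fun t => prodHat (u t) (u t) k := by
  rw [continuous_iff_continuousAt]
  intro t₀
  rw [ContinuousAt, tendsto_iff_norm_sub_tendsto_zero]
  have hb : ∀ t, ‖prodHat (u t) (u t) k - prodHat (u t₀) (u t₀) k‖ ≤
      (hsNorm s (u t) + hsNorm s (u t₀)) * hsNorm s (fun k => u t k - u t₀ k) := by
    intro t
    rw [prodHat_diff hs (hu.1 t) (hu.1 t₀)]
    refine (prodHat_norm_le hs (MemHs_add (hu.1 t) (hu.1 t₀)).1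
      (MemHs_sub (hu.1 t) (hu.1 t₀)).1 k).trans ?_
    exact mul_le_mul_of_nonneg_right (hsNorm_add_le (hu.1 t) (hu.1 t₀)) (hsNorm_nonneg _ _)
  refine squeeze_zero (fun _ => norm_nonneg _) hb ?_
  have := ((hu.cont.tendsto t₀).add_const (hsNorm s (u t₀))).mul (hu.2 t₀)
  simpa using this

lemma cs_int {g : ℝ → ℝ} (hg : Continuous g) {t : ℝ} (ht : 0 ≤ t) :
    (∫ τ in (0:ℝ)..t, g τ) ^ 2 ≤ t * ∫ τ in (0:ℝ)..t, g τ ^ 2 := by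
  rcases ht.eq_or_lt with rfl | ht
  · simp
  set A := ∫ τ in (0:ℝ)..t, g τ with hA
  have h0 : 0 ≤ ∫ τ in (0:ℝ)..t, (g τ - A / t) ^ 2 :=
    intervalIntegral.integral_nonneg ht.le fun _ _ => sq_nonneg _
  have e : ∫ τ in (0:ℝ)..t, (g τ - A / t) ^ 2 =
      (∫ τ in (0:ℝ)..t, g τ ^ 2) - 2 * (A / t) * A + t * (A / t) ^ 2 := by
    have : ∀ τ, (g τ - A / t) ^ 2 = g τ ^ 2 - 2 * (A / t) * g τ + (A / t) ^ 2 := by intro τ; ring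
    simp only [this]
    rw [intervalIntegral.integral_add, intervalIntegral.integral_sub,
      intervalIntegral.integral_const_mul, ← hA]
    · simp
    all_goals apply Continuous.intervalIntegrable; fun_prop
  rw [e] at h0
  have e2 : t * ((∫ τ in (0:ℝ)..t, g τ ^ 2) - 2 * (A / t) * A + t * (A / t) ^ 2) =
      t * (∫ τ in (0:ℝ)..t, g τ ^ 2) - A ^ 2 := by field_simp; ring
  nlinarith [mul_nonneg ht.le h0]

lemma norm_int_sgn {F : ℝ → ℂ} {σ t : ℝ} (hσ : σ = 1 ∨ σ = -1) (ht : 0 ≤ t) :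
    ‖∫ τ in (0:ℝ)..(σ * t), F τ‖ ≤ ∫ τ in (0:ℝ)..t, ‖F (σ * τ)‖ := by
  rcases hσ with rfl | rfl
  · simpa using intervalIntegral.norm_integral_le_integral_norm ht
  · have e : ∫ τ in (0:ℝ)..(-1 * t), F τ = - ∫ τ in (0:ℝ)..t, F (-1 * τ) := by
      have := intervalIntegral.integral_comp_neg (f := F) (a := 0) (b := t)
      simp only [neg_one_mul]
      rw [this, neg_zero, intervalIntegral.integral_symm]
    rw [e, norm_neg]
    exact intervalIntegral.norm_integral_le_integral_norm ht

/-- difference of nonlinear parts -/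
def DD (u₀ v₀ : ℤ → ℂ) (u v : ℝ → ℤ → ℂ) (t : ℝ) : ℤ → ℂ := fun k =>
  Complex.exp (Complex.I * t * phiSymb k) * (u t k - v t k) - (u₀ k - v₀ k)

lemma duhamel {u₀ : ℤ → ℂ} {u : ℝ → ℤ → ℂ} {t : ℝ} (h : SolvesBBM u₀ u t) (k : ℤ) :
    Complex.exp (Complex.I * t * phiSymb k) * u t k - u₀ k = - (Complex.I / 2) *
      ∫ τ in (0:ℝ)..t, Complex.exp (Complex.I * τ * phiSymb k) * (phiSymb k : ℂ) *
        prodHat (u τ) (u τ) k := by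
  rw [h k, freeEvol]
  have e1 : Complex.exp (Complex.I * t * phiSymb k) * Complex.exp (-Complex.I * t * phiSymb k) = 1 := by
    rw [← Complex.exp_add]; ring_nf; simp
  have e2 : ∫ τ in (0:ℝ)..t, Complex.exp (Complex.I * τ * phiSymb k) * (phiSymb k : ℂ) *
        prodHat (u τ) (u τ) k = Complex.exp (Complex.I * t * phiSymb k) *
        ∫ τ in (0:ℝ)..t, Complex.exp (-Complex.I * (t - τ) * phiSymb k) * (phiSymb k : ℂ) *
        prodHat (u τ) (u τ) k := by
    rw [← intervalIntegral.integral_const_mul]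
    congr 1; funext τ
    rw [← mul_assoc, ← mul_assoc, ← Complex.exp_add]
    congr 4; ring
  rw [e2, mul_sub, ← mul_assoc, e1]; ring

lemma DD_eq {s : ℝ} (hs : 0 ≤ s) {u₀ v₀ : ℤ → ℂ} {u v : ℝ → ℤ → ℂ}
    (hu : HC s u) (hv : HC s v) {t : ℝ} (hu' : SolvesBBM u₀ u t) (hv' : SolvesBBM v₀ v t) (k : ℤ) :
    DD u₀ v₀ u v t k = - (Complex.I / 2) *
      ∫ τ in (0:ℝ)..t, Complex.exp (Complex.I * τ * phiSymb k) * (phiSymb k : ℂ) *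
        prodHat (fun k => u τ k + v τ k) (fun k => u τ k - v τ k) k := by
  have h1 := duhamel hu' k
  have h2 := duhamel hv' k
  have e : DD u₀ v₀ u v t k = (Complex.exp (Complex.I * t * phiSymb k) * u t k - u₀ k) -
      (Complex.exp (Complex.I * t * phiSymb k) * v t k - v₀ k) := by unfold DD; ring
  rw [e, h1, h2, ← mul_sub, ← intervalIntegral.integral_sub]
  · congr 2; funext τ
    rw [← mul_sub, prodHat_diff hs (hu.1 τ) (hv.1 τ)]
  · have := hu.prod hs k
    apply Continuous.intervalIntegrable; fun_prop
  · have := hv.prod hs k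
    apply Continuous.intervalIntegrable; fun_prop

lemma DD_norm {s : ℝ} (hs : 0 ≤ s) {u₀ v₀ : ℤ → ℂ} {u v : ℝ → ℤ → ℂ}
    (hu : HC s u) (hv : HC s v) {σ t : ℝ} (hσ : σ = 1 ∨ σ = -1) (ht : 0 ≤ t)
    (hu' : SolvesBBM u₀ u (σ * t)) (hv' : SolvesBBM v₀ v (σ * t)) (k : ℤ) :
    ‖DD u₀ v₀ u v (σ * t) k‖ ^ 2 ≤ t / 4 * ∫ τ in (0:ℝ)..t, phiSymb k ^ 2 *
      ‖prodHat (fun k => u (σ * τ) k + v (σ * τ) k) (fun k => u (σ * τ) k - v (σ * τ) k) k‖ ^ 2 := by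
  have hc : Continuous fun τ => prodHat (fun k => u τ k + v τ k) (fun k => u τ k - v τ k) k := by
    simp only [← prodHat_diff hs (hu.1 _) (hv.1 _)]
    exact (hu.prod hs k).sub (hv.prod hs k)
  set P := fun τ => prodHat (fun k => u τ k + v τ k) (fun k => u τ k - v τ k) k with hP
  have h1 : ‖DD u₀ v₀ u v (σ * t) k‖ ≤ 1 / 2 * ∫ τ in (0:ℝ)..t, |phiSymb k| * ‖P (σ * τ)‖ := by
    rw [DD_eq hs hu hv hu' hv' k, norm_mul]
    have e0 : ‖-(Complex.I / 2)‖ = 1 / 2 := by simp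
    rw [e0]
    refine mul_le_mul_of_nonneg_left ((norm_int_sgn hσ ht).trans (le_of_eq ?_)) (by norm_num)
    congr 1; funext τ
    rw [norm_mul, norm_mul, Complex.norm_exp]
    simp [P]
  have h2 : (∫ τ in (0:ℝ)..t, |phiSymb k| * ‖P (σ * τ)‖) ^ 2 ≤
      t * ∫ τ in (0:ℝ)..t, (|phiSymb k| * ‖P (σ * τ)‖) ^ 2 := cs_int (by fun_prop) ht
  simp only [mul_pow, sq_abs] at h2
  have h3 := pow_le_pow_left₀ (norm_nonneg _) h1 2
  rw [mul_pow] at h3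
  simp only [P] at h2 h3
  linarith

lemma DD_Q {s : ℝ} (hs : 1 < 4 * s) {u₀ v₀ : ℤ → ℂ} {u v : ℝ → ℤ → ℂ}
    (hu : HC s u) (hv : HC s v) {σ t : ℝ} (hσ : σ = 1 ∨ σ = -1) (ht : 0 ≤ t)
    (hu' : SolvesBBM u₀ u (σ * t)) (hv' : SolvesBBM v₀ v (σ * t)) {B : ℝ}
    (hB : ∀ τ ∈ Set.Icc 0 t, Q s (fun k => u (σ * τ) k + v (σ * τ) k) ≤ B) :
    MemHs (1 - s) (DD u₀ v₀ u v (σ * t)) ∧ Q (1 - s) (DD u₀ v₀ u v (σ * t)) ≤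
      t / 4 * ((∑' k, wt (-(2 * s)) k) * B *
        ∫ τ in (0:ℝ)..t, Q s (fun k => u (σ * τ) k - v (σ * τ) k)) := by
  have hs0 : 0 ≤ s := by linarith
  apply memHs_of_le
  intro S
  have hc : ∀ k, Continuous fun τ => prodHat (fun k => u (σ * τ) k + v (σ * τ) k)
      (fun k => u (σ * τ) k - v (σ * τ) k) k := by
    intro k
    have hc : Continuous fun τ => prodHat (fun k => u τ k + v τ k) (fun k => u τ k - v τ k) k := by
      simp only [← prodHat_diff hs0 (hu.1 _) (hv.1 _)]
      exact (hu.prod hs0 k).sub (hv.prod hs0 k)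
    exact hc.comp (continuous_const.mul continuous_id)
  have hcQ : Continuous fun τ => Q s (fun k => u (σ * τ) k - v (σ * τ) k) :=
    (hu.sub hv).contQ.comp (continuous_const.mul continuous_id)
  calc ∑ k ∈ S, wt (1 - s) k * ‖DD u₀ v₀ u v (σ * t) k‖ ^ 2
      ≤ ∑ k ∈ S, wt (1 - s) k * (t / 4 * ∫ τ in (0:ℝ)..t, phiSymb k ^ 2 *
      ‖prodHat (fun k => u (σ * τ) k + v (σ * τ) k) (fun k => u (σ * τ) k - v (σ * τ) k) k‖ ^ 2) :=
        Finset.sum_le_sum fun k _ =>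
          mul_le_mul_of_nonneg_left (DD_norm hs0 hu hv hσ ht hu' hv' k) (wt_pos _ _).le
    _ = t / 4 * ∫ τ in (0:ℝ)..t, ∑ k ∈ S, wt (1 - s) k * (phiSymb k ^ 2 *
      ‖prodHat (fun k => u (σ * τ) k + v (σ * τ) k)
        (fun k => u (σ * τ) k - v (σ * τ) k) k‖ ^ 2) := by
        rw [intervalIntegral.integral_finsetSum, Finset.mul_sum]
        · refine Finset.sum_congr rfl fun k _ => ?_
          rw [intervalIntegral.integral_const_mul (wt (1 - s) k)]; ring
        · intro k _
          have := hc k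
          apply Continuous.intervalIntegrable; fun_prop
    _ ≤ t / 4 * ∫ τ in (0:ℝ)..t, ((∑' k, wt (-(2 * s)) k) * B) *
          Q s (fun k => u (σ * τ) k - v (σ * τ) k) := by
        refine mul_le_mul_of_nonneg_left ?_ (by linarith)
        refine intervalIntegral.integral_mono_on ht ?_ ?_ fun τ hτ => ?_
        · apply Continuous.intervalIntegrable
          exact continuous_finsetSum _ fun k _ => by have := hc k; fun_prop
        · apply Continuous.intervalIntegrable; fun_prop
        · refine (bilin hs (MemHs_add (hu.1 _) (hv.1 _)).1
            (MemHs_sub (hu.1 _) (hv.1 _)).1 S).trans ?_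
          rw [mul_assoc]
          refine mul_le_mul_of_nonneg_left ?_ (tsum_nonneg fun k => (wt_pos _ k).le)
          exact mul_le_mul_of_nonneg_right (hB τ hτ) (Q_nonneg _ _)
    _ = _ := by rw [intervalIntegral.integral_const_mul]

lemma gronwall_int {y : ℝ → ℝ} (hy : Continuous y) {a b T : ℝ} (hb : 0 ≤ b)
    (h : ∀ t ∈ Set.Icc 0 T, y t ≤ a + b * ∫ τ in (0:ℝ)..t, y τ) :
    ∀ t ∈ Set.Icc 0 T, y t ≤ a * Real.exp (b * t) := by
  intro t ht
  have hd : ∀ x, HasDerivAt (fun x => (a + b * ∫ τ in (0:ℝ)..x, y τ) * Real.exp (-(b * x)))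
      (b * y x * Real.exp (-(b * x)) +
        (a + b * ∫ τ in (0:ℝ)..x, y τ) * (Real.exp (-(b * x)) * (-(b * 1)))) x := by
    intro x
    have h1 := ((hy.integral_hasStrictDerivAt 0 x).hasDerivAt.const_mul b).const_add a
    have h2 : HasDerivAt (fun x => Real.exp (-(b * x))) (Real.exp (-(b * x)) * (-(b * 1))) x :=
      (((hasDerivAt_id x).const_mul b).neg).exp
    exact h1.mul h2
  have hanti : AntitoneOn (fun x => (a + b * ∫ τ in (0:ℝ)..x, y τ) * Real.exp (-(b * x)))
      (Set.Icc 0 T) := by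
    refine antitoneOn_of_deriv_nonpos (convex_Icc _ _)
      (fun x _ => (hd x).continuousAt.continuousWithinAt)
      (fun x _ => (hd x).differentiableAt.differentiableWithinAt) fun x hx => ?_
    rw [(hd x).deriv]
    have := h x (interior_subset hx)
    have := mul_nonneg hb (mul_nonneg (Real.exp_pos (-(b * x))).le (sub_nonneg.2 this))
    nlinarith
  have h0 := hanti ⟨le_rfl, ht.1.trans ht.2⟩ ht ht.1
  simp only [intervalIntegral.integral_same, mul_zero, neg_zero, Real.exp_zero, add_zero,
    mul_one] at h0
  refine (h t ht).trans ?_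
  have e : Real.exp (-(b * t)) * Real.exp (b * t) = 1 := by
    rw [← Real.exp_add]; simp
  have := mul_le_mul_of_nonneg_right h0 (Real.exp_pos (b * t)).le
  rwa [mul_assoc, e, mul_one] at this

lemma bootstrap {y : ℝ → ℝ} (hy : Continuous y) {T : ℝ}
    (h : ∀ t ∈ Set.Icc 0 T, (∀ τ ∈ Set.Icc 0 t, y τ ≤ 1) → y t ≤ 1 / 2) (h0 : y 0 ≤ 1 / 2) :
    ∀ t ∈ Set.Icc 0 T, y t ≤ 1 := by
  by_contra hcon
  push Not at hcon
  obtain ⟨t₁, ht₁, hy₁⟩ := hcon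
  set A := {t | t ∈ Set.Icc 0 t₁ ∧ 1 ≤ y t} with hA
  have hAc : IsClosed A := isClosed_Icc.inter (isClosed_le continuous_const hy)
  have hAn : A.Nonempty := ⟨t₁, ⟨ht₁.1, le_rfl⟩, hy₁.le⟩
  have hAb : BddBelow A := ⟨0, fun t ht => ht.1.1⟩
  have hm := hAc.csInf_mem hAn hAb
  set m := sInf A with hmdef
  have hlt : ∀ τ, 0 ≤ τ → τ < m → y τ < 1 := by
    intro τ h0 hτ
    by_contra hc
    have : τ ∈ A := ⟨⟨h0, hτ.le.trans hm.1.2⟩, not_lt.1 hc⟩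
    exact absurd (csInf_le hAb this) (not_le.2 hτ)
  have hmpos : 0 < m := by
    rcases hm.1.1.eq_or_lt with h | h
    · have := hm.2; rw [← h] at this; linarith
    · exact h
  have hmle : y m ≤ 1 := by
    have ht : Filter.Tendsto y (nhdsWithin m (Set.Iio m)) (nhds (y m)) :=
      (hy.tendsto m).mono_left nhdsWithin_le_nhds
    refine le_of_tendsto ht ?_
    filter_upwards [Ioo_mem_nhdsLT hmpos] with τ hτ
    exact (hlt τ hτ.1.le hτ.2).le
  have := h m ⟨hm.1.1, hm.1.2.trans ht₁.2⟩ fun τ hτ => by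
    rcases hτ.2.eq_or_lt with h | h
    · rw [h]; exact hmle
    · exact (hlt τ hτ.1 h).le
  linarith [hm.2]

lemma w_est {s : ℝ} (hs : 1 < 4 * s) (hs1 : 2 * s ≤ 1) {u₀ v₀ : ℤ → ℂ} {u v : ℝ → ℤ → ℂ}
    (hu : HC s u) (hv : HC s v) {σ T T' : ℝ} (hσ : σ = 1 ∨ σ = -1) (hT : T' ≤ T)
    (hu0 : MemHs s u₀) (hv0 : MemHs s v₀)
    (hu' : ∀ t, SolvesBBM u₀ u t) (hv' : ∀ t, SolvesBBM v₀ v t) {B : ℝ} (hB0 : 0 ≤ B)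
    (hB : ∀ τ ∈ Set.Icc 0 T', Q s (fun k => u (σ * τ) k + v (σ * τ) k) ≤ B) :
    ∀ t ∈ Set.Icc 0 T', Q s (fun k => u (σ * t) k - v (σ * t) k) ≤
      2 * Q s (fun k => u₀ k - v₀ k) *
        Real.exp (T / 2 * ((∑' k, wt (-(2 * s)) k) * B) * T) := by
  have hM0 : 0 ≤ ∑' k, wt (-(2 * s)) k := tsum_nonneg fun k => (wt_pos _ k).le
  set M := ∑' k, wt (-(2 * s)) k with hM
  have hw0 := (MemHs_sub hu0 hv0).1
  have hcQ : Continuous fun τ => Q s (fun k => u (σ * τ) k - v (σ * τ) k) :=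
    (hu.sub hv).contQ.comp (continuous_const.mul continuous_id)
  intro t ht
  have hT0 : 0 ≤ T := ht.1.trans (ht.2.trans hT)
  have hg := gronwall_int hcQ (a := 2 * Q s (fun k => u₀ k - v₀ k)) (b := T / 2 * (M * B))
    (T := T') (by positivity) (fun t ht => by
      obtain ⟨h1, h2⟩ := DD_Q hs hu hv hσ ht.1 (hu' _) (hv' _)
        (fun τ hτ => hB τ ⟨hτ.1, hτ.2.trans ht.2⟩)
      have hle : s ≤ 1 - s := by linarith
      have h3 := (MemHs_add (h1.mono hle) hw0).2
      have h4 : Q s (fun k => u (σ * t) k - v (σ * t) k) =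
          Q s (fun k => DD u₀ v₀ u v (σ * t) k + (u₀ k - v₀ k)) := by
        refine (Q_congr fun k => ?_).2
        unfold DD
        rw [sub_add_cancel, norm_mul, Complex.norm_exp]
        simp
      rw [h4]
      have h5 := Q_mono hle h1
      have hI : 0 ≤ ∫ τ in (0:ℝ)..t, Q s (fun k => u (σ * τ) k - v (σ * τ) k) :=
        intervalIntegral.integral_nonneg ht.1 fun _ _ => Q_nonneg _ _
      have h6 : t / 4 * (M * B * ∫ τ in (0:ℝ)..t, Q s (fun k => u (σ * τ) k - v (σ * τ) k)) ≤
          T / 4 * (M * B * ∫ τ in (0:ℝ)..t, Q s (fun k => u (σ * τ) k - v (σ * τ) k)) := by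
        have : t ≤ T := ht.2.trans hT
        gcongr
      linarith) t ht
  refine hg.trans ?_
  have := Q_nonneg s (fun k => u₀ k - v₀ k)
  have : t ≤ T := ht.2.trans hT
  gcongr

lemma final_est {s : ℝ} (hs : 1 < 4 * s) (hs1 : 2 * s ≤ 1) {u₀ v₀ : ℤ → ℂ} {u v : ℝ → ℤ → ℂ}
    (hu : HC s u) (hv : HC s v) {σ T : ℝ} (hσ : σ = 1 ∨ σ = -1)
    (hu0 : MemHs s u₀) (hv0 : MemHs s v₀)
    (hu' : ∀ t, SolvesBBM u₀ u t) (hv' : ∀ t, SolvesBBM v₀ v t) {B : ℝ} (hB0 : 0 ≤ B)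
    (hB : ∀ τ ∈ Set.Icc 0 T, Q s (fun k => u (σ * τ) k + v (σ * τ) k) ≤ B) :
    ∀ t ∈ Set.Icc 0 T, Q (1 - s) (DD u₀ v₀ u v (σ * t)) ≤
      T / 4 * ((∑' k, wt (-(2 * s)) k) * B * (T * (2 *
        Real.exp (T / 2 * ((∑' k, wt (-(2 * s)) k) * B) * T)))) *
      Q s (fun k => u₀ k - v₀ k) := by
  intro t ht
  have hw := w_est hs hs1 hu hv hσ le_rfl hu0 hv0 hu' hv' hB0 hB
  have hM0 : 0 ≤ ∑' k, wt (-(2 * s)) k := tsum_nonneg fun k => (wt_pos _ k).le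
  set M := ∑' k, wt (-(2 * s)) k with hM
  set E := Real.exp (T / 2 * (M * B) * T) with hE
  have hE0 : 0 < E := Real.exp_pos _
  have hcQ : Continuous fun τ => Q s (fun k => u (σ * τ) k - v (σ * τ) k) :=
    (hu.sub hv).contQ.comp (continuous_const.mul continuous_id)
  have h2 := (DD_Q hs hu hv hσ ht.1 (hu' _) (hv' _)
        (fun τ hτ => hB τ ⟨hτ.1, hτ.2.trans ht.2⟩)).2
  have hq := Q_nonneg s (fun k => u₀ k - v₀ k)
  have hI : ∫ τ in (0:ℝ)..t, Q s (fun k => u (σ * τ) k - v (σ * τ) k) ≤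
      T * (2 * Q s (fun k => u₀ k - v₀ k) * E) := by
    have : ∫ τ in (0:ℝ)..t, Q s (fun k => u (σ * τ) k - v (σ * τ) k) ≤
        ∫ τ in (0:ℝ)..t, (2 * Q s (fun k => u₀ k - v₀ k) * E) :=
      intervalIntegral.integral_mono_on ht.1 (hcQ.intervalIntegrable _ _) (by simp)
        fun τ hτ => hw τ ⟨hτ.1, hτ.2.trans ht.2⟩
    rw [intervalIntegral.integral_const, sub_zero, smul_eq_mul] at this
    have h3 := ht.2
    refine this.trans ?_
    gcongr
  have hI0 : 0 ≤ ∫ τ in (0:ℝ)..t, Q s (fun k => u (σ * τ) k - v (σ * τ) k) :=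
    intervalIntegral.integral_nonneg ht.1 fun _ _ => Q_nonneg _ _
  have h3 := ht.2
  have hT0 : 0 ≤ T := ht.1.trans h3
  calc _ ≤ _ := h2
    _ ≤ T / 4 * (M * B * (T * (2 * Q s (fun k => u₀ k - v₀ k) * E))) := by gcongr
    _ = _ := by ring

/-- stability -/
lemma stab {s : ℝ} (hs : 1 < 4 * s) (hs1 : 2 * s ≤ 1) (A T : ℝ) (hA : 0 ≤ A) :
    ∃ δ : ℝ, 0 < δ ∧ ∀ (u₀ v₀ : ℤ → ℂ) (u v : ℝ → ℤ → ℂ) (σ : ℝ), HC s u → HC s v →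
      (σ = 1 ∨ σ = -1) → MemHs s u₀ → MemHs s v₀ → u 0 = u₀ → v 0 = v₀ →
      (∀ t, SolvesBBM u₀ u t) → (∀ t, SolvesBBM v₀ v t) →
      (∀ t ∈ Set.Icc 0 T, Q s (u (σ * t)) ≤ A) →
      Q s (fun k => u₀ k - v₀ k) < δ →
      ∀ t ∈ Set.Icc 0 T, Q s (v (σ * t)) ≤ 2 * A + 2 := by
  set E := Real.exp (T / 2 * ((∑' k, wt (-(2 * s)) k) * (8 * A + 2)) * T) with hE
  have hE0 : 0 < E := Real.exp_pos _
  refine ⟨min (1/2) (1 / (4 * E)), by positivity, ?_⟩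
  intro u₀ v₀ u v σ hu hv hσ hu0 hv0 huz hvz hu' hv' hAu hδ
  have hcQ : Continuous fun τ => Q s (fun k => u (σ * τ) k - v (σ * τ) k) :=
    (hu.sub hv).contQ.comp (continuous_const.mul continuous_id)
  have hb := bootstrap hcQ (T := T) (fun t ht hy => by
    have := w_est hs hs1 hu hv hσ ht.2 hu0 hv0 hu' hv' (B := 8 * A + 2) (by positivity)
      (fun τ hτ => by
        have h1 := MemHs_smul 2 (hu.1 (σ * τ))
        have h2 := (MemHs_sub h1.1 (MemHs_sub (hu.1 (σ * τ)) (hv.1 (σ * τ))).1).2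
        rw [h1.2] at h2
        have h3 : (fun k => u (σ * τ) k + v (σ * τ) k) =
            (fun k => 2 * u (σ * τ) k - (u (σ * τ) k - v (σ * τ) k)) := by funext k; ring
        rw [h3]
        have h4 := hAu τ ⟨hτ.1, hτ.2.trans ht.2⟩
        have h5 := hy τ hτ
        norm_num at h2
        linarith) t ⟨ht.1, le_rfl⟩
    refine this.trans ?_
    rw [← hE]
    have h6 : Q s (fun k => u₀ k - v₀ k) ≤ 1 / (4 * E) := hδ.le.trans (min_le_right _ _)
    rw [le_div_iff₀ (by positivity)] at h6
    linarith) (by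
      simp only [mul_zero, huz, hvz]
      exact hδ.le.trans (min_le_left _ _))
  intro t ht
  have h2 := (MemHs_sub (hu.1 (σ * t)) (MemHs_sub (hu.1 (σ * t)) (hv.1 (σ * t))).1).2
  simp only [sub_sub_cancel] at h2
  have := hAu t ht
  have := hb t ht
  linarith

/-- compact set of data -/
def KK (R : ℝ) : Set (ℤ → ℂ) :=
  {u | IsRealSeq u ∧ ∀ S : Finset ℤ, ∑ k ∈ S, wt (1/2) k * ‖u k‖ ^ 2 ≤ R ^ 2}

lemma KK_compact (R : ℝ) (hR : 0 ≤ R) : IsCompact (KK R) := by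
  have hc : IsCompact (Set.pi Set.univ fun _ : ℤ => Metric.closedBall (0:ℂ) R) :=
    isCompact_univ_pi fun _ => isCompact_closedBall _ _
  refine hc.of_isClosed_subset ?_ ?_
  · have : KK R = (⋂ k : ℤ, {u : ℤ → ℂ | u (-k) = conj (u k)}) ∩
        ⋂ S : Finset ℤ, {u | ∑ k ∈ S, wt (1/2) k * ‖u k‖ ^ 2 ≤ R ^ 2} := by
      ext u; simp [KK, IsRealSeq]
    rw [this]
    refine IsClosed.inter (isClosed_iInter fun k => ?_) (isClosed_iInter fun S => ?_)
    · exact isClosed_eq (continuous_apply _) (Complex.continuous_conj.comp (continuous_apply _))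
    · exact isClosed_le (by fun_prop) continuous_const
  · intro u hu k _
    have h1 := hu.2 {k}
    rw [Finset.sum_singleton] at h1
    have h2 := wt_mono (show (0:ℝ) ≤ 1/2 by norm_num) k
    rw [wt_zero] at h2
    rw [mem_closedBall_zero_iff]
    refine abs_le_of_sq_le_sq' ?_ hR |>.2
    nlinarith [sq_nonneg ‖u k‖]

lemma KK_nhds {s : ℝ} (hs1 : s < 1/2) (R : ℝ) {u : ℤ → ℂ} (hu : u ∈ KK R)
    {δ : ℝ} (hδ : 0 < δ) : {v | Q s (fun k => u k - v k) < δ} ∈ nhdsWithin u (KK R) := by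
  have hu' := memHs_of_le hu.2
  -- tail smallness
  set r := 1/2 - s with hr
  have hr0 : 0 < r := by linarith
  have htend : Filter.Tendsto (fun x : ℝ => (1 + x ^ 2) ^ (-r)) Filter.atTop (nhds 0) := by
    refine (tendsto_rpow_neg_atTop hr0).comp ?_
    exact Filter.tendsto_atTop_add_const_left _ _ (Filter.tendsto_pow_atTop two_ne_zero)
  obtain ⟨N, hN⟩ : ∃ N : ℕ, (1 + (N:ℝ) ^ 2) ^ (-r) * (4 * R ^ 2) < δ / 2 := by
    have := ((htend.comp tendsto_natCast_atTop_atTop).mul_const (4 * R ^ 2))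
    rw [zero_mul] at this
    exact (this.eventually (gt_mem_nhds (half_pos hδ))).exists
  set F := Finset.Icc (-(N:ℤ)) N with hF
  have hcont : Continuous fun v : ℤ → ℂ => ∑ k ∈ F, wt s k * ‖u k - v k‖ ^ 2 := by fun_prop
  have hnear : ∀ᶠ v in nhdsWithin u (KK R), ∑ k ∈ F, wt s k * ‖u k - v k‖ ^ 2 < δ / 2 := by
    have h := (hcont.tendsto u).mono_left (nhdsWithin_le_nhds (s := KK R))
    simp only [sub_self, norm_zero, ne_eq, OfNat.ofNat_ne_zero, not_false_eq_true, zero_pow,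
      mul_zero, Finset.sum_const_zero] at h
    exact h.eventually (gt_mem_nhds (half_pos hδ))
  filter_upwards [hnear, self_mem_nhdsWithin] with v hv hvK
  have hv' := memHs_of_le hvK.2
  have hd := MemHs_sub hu'.1 hv'.1
  have hd4 : Q (1/2) (fun k => u k - v k) ≤ 4 * R ^ 2 := by linarith [hu'.2, hv'.2, hd.2]
  set ρ := (1 + (N:ℝ) ^ 2) ^ (-r) with hρ
  have hρ0 : 0 < ρ := by positivity
  have hle : Q s (fun k => u k - v k) ≤ ∑ k ∈ F, wt s k * ‖u k - v k‖ ^ 2 +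
      ρ * (4 * R ^ 2) := by
    refine (memHs_of_le (s := s) (u := fun k => u k - v k) fun S => ?_).2
    have hterm : ∀ k ∈ S, wt s k * ‖u k - v k‖ ^ 2 ≤
        (if k ∈ F then wt s k * ‖u k - v k‖ ^ 2 else 0) +
          ρ * (wt (1/2) k * ‖u k - v k‖ ^ 2) := by
      intro k _
      split_ifs with hk
      · have := mul_nonneg hρ0.le (term_nonneg (1/2) (fun k => u k - v k) k)
        linarith
      · rw [zero_add, ← mul_assoc]
        refine mul_le_mul_of_nonneg_right ?_ (by positivity)
        have e : wt s k = wt (-r) k * wt (1/2) k := by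
          rw [← wt_add]; congr 1; rw [hr]; ring
        rw [e]
        refine mul_le_mul_of_nonneg_right ?_ (wt_pos _ _).le
        unfold wt
        refine Real.rpow_le_rpow_of_nonpos (by positivity) ?_ (by linarith)
        have hk2 : (N:ℤ) ≤ |k| := by
          rw [hF, Finset.mem_Icc, ← abs_le] at hk
          omega
        have hk3 : (N:ℝ) ≤ |(k:ℝ)| := by exact_mod_cast hk2
        have := pow_le_pow_left₀ (by positivity) hk3 2
        rw [sq_abs] at this
        linarith
    refine (Finset.sum_le_sum hterm).trans ?_
    rw [Finset.sum_add_distrib, ← Finset.mul_sum]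
    refine add_le_add ?_ (mul_le_mul_of_nonneg_left ?_ hρ0.le)
    · rw [← Finset.sum_filter]
      refine Finset.sum_le_sum_of_subset_of_nonneg ?_
        fun k _ _ => term_nonneg s (fun k => u k - v k) k
      intro k hk; exact (Finset.mem_filter.1 hk).2
    · exact (hd.1.sum_le_tsum S fun k _ => term_nonneg (1/2) (fun k => u k - v k) k).trans hd4
  show Q s (fun k => u k - v k) < δ
  linarith

lemma flow_HC {Φ : ℝ → (ℤ → ℂ) → ℤ → ℂ} (hΦ : IsGlobalFlow (1/2) Φ) {s : ℝ} (hs : s ≤ 1/2)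
    {u₀ : ℤ → ℂ} (hr : IsRealSeq u₀) (hu : MemHs (1/2) u₀) : HC s fun t => Φ t u₀ := by
  obtain ⟨_, h2, h3, _⟩ := hΦ u₀ hr hu
  refine ⟨fun t => (h2 t).1.mono hs, fun t₀ => ?_⟩
  rw [Metric.tendsto_nhds]
  intro η hη
  obtain ⟨δ, hδ, h⟩ := (h3 (|t₀| + 1) (by positivity)).2 t₀
    (abs_le.1 (by linarith)) η hη
  filter_upwards [Metric.ball_mem_nhds t₀ (lt_min hδ one_pos)] with t ht
  rw [Metric.mem_ball, Real.dist_eq, lt_min_iff] at ht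
  have h4 := h t (abs_le.1 (by
    have := abs_add_le (t - t₀) t₀
    rw [sub_add_cancel] at this
    linarith)) ht.1
  rw [Real.dist_eq, sub_zero, abs_of_nonneg (hsNorm_nonneg _ _)]
  refine lt_of_le_of_lt (Real.sqrt_le_sqrt ?_) h4
  exact Q_mono hs (MemHs_sub (h2 t).1 (h2 t₀).1).1

lemma unif_bound {Φ : ℝ → (ℤ → ℂ) → ℤ → ℂ} (hΦ : IsGlobalFlow (1/2) Φ) {s : ℝ}
    (hs : 1 < 4 * s) (hs1 : s < 1/2) (R T : ℝ) (hR : 0 ≤ R) (σ : ℝ) (hσ : σ = 1 ∨ σ = -1) :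
    ∃ B : ℝ, ∀ v ∈ KK R, ∀ t ∈ Set.Icc 0 T, Q s (Φ (σ * t) v) ≤ B := by
  have := (KK_compact R hR).induction_on
    (p := fun S => ∃ B : ℝ, ∀ v ∈ S ∩ KK R, ∀ t ∈ Set.Icc 0 T, Q s (Φ (σ * t) v) ≤ B)
    ⟨0, by simp⟩
    (fun S S' hSS ⟨B, hB⟩ => ⟨B, fun v hv => hB v ⟨hSS hv.1, hv.2⟩⟩)
    (fun S S' ⟨B, hB⟩ ⟨B', hB'⟩ => ⟨max B B', fun v hv t ht => by
      rcases hv.1 with h | h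
      · exact (hB v ⟨h, hv.2⟩ t ht).trans (le_max_left _ _)
      · exact (hB' v ⟨h, hv.2⟩ t ht).trans (le_max_right _ _)⟩)
    (fun u hu => by
      have hm := (memHs_of_le hu.2).1
      have hc := flow_HC hΦ hs1.le hu.1 hm
      have hcQ : Continuous fun t => Q s (Φ (σ * t) u) :=
        hc.contQ.comp (continuous_const.mul continuous_id)
      obtain ⟨A, hA⟩ := (isCompact_Icc (a := (0:ℝ)) (b := T)).bddAbove_image hcQ.continuousOn
      obtain ⟨δ, hδ, hst⟩ := stab hs (by linarith) (max A 0) T (le_max_right _ _)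
      refine ⟨_, KK_nhds hs1 R hu hδ, 2 * max A 0 + 2, ?_⟩
      rintro v ⟨hv1, hv⟩
      have hmv := (memHs_of_le hv.2).1
      obtain ⟨a1, _, _, a4⟩ := hΦ u hu.1 hm
      obtain ⟨b1, _, _, b4⟩ := hΦ v hv.1 hmv
      exact hst u v (fun t => Φ t u) (fun t => Φ t v) σ hc (flow_HC hΦ hs1.le hv.1 hmv) hσ
        (hm.mono hs1.le) (hmv.mono hs1.le) a1 b1 a4 b4
        (fun t ht => (hA ⟨t, ht, rfl⟩).trans (le_max_left _ _)) hv1)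
  obtain ⟨B, hB⟩ := this
  exact ⟨B, fun v hv => hB v ⟨hv, hv⟩⟩

/-- (H3) for BBM. For every `0 < ε < 1/12` and `R, T > 0` there is a
constant `C` such that for all `u₀, v₀ ∈ B_R(H^{1/2}(𝕋))` and `|t| ≤ T`,
`‖Φ̃_t(u₀) - Φ̃_t(v₀)‖_{H^{1/2+ε}} ≤ C ‖u₀ - v₀‖_{H^{1/2-ε}}`. -/
theorem nonlinPart_compactness
    (Φ : ℝ → (ℤ → ℂ) → ℤ → ℂ) (hΦ : IsGlobalFlow (1/2) Φ)
    (ε : ℝ) (hε0 : 0 < ε) (hε : ε < 1/12) (R T : ℝ) (hR : 0 < R) (hT : 0 < T) :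
    ∃ C : ℝ, 0 < C ∧ ∀ u₀ v₀ : ℤ → ℂ,
      IsRealSeq u₀ → MemHs (1/2) u₀ → hsNorm (1/2) u₀ < R →
      IsRealSeq v₀ → MemHs (1/2) v₀ → hsNorm (1/2) v₀ < R →
      ∀ t : ℝ, |t| ≤ T →
        hsNorm (1/2 + ε) (fun k => nonlinPart Φ t u₀ k - nonlinPart Φ t v₀ k) ≤
          C * hsNorm (1/2 - ε) (fun k => u₀ k - v₀ k) := by
  set s : ℝ := 1/2 - ε with hs
  have hs4 : 1 < 4 * s := by rw [hs]; linarith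
  have hs2 : s < 1/2 := by rw [hs]; linarith
  have h1s : 1/2 + ε = 1 - s := by rw [hs]; ring
  obtain ⟨B₁, hB₁⟩ := unif_bound hΦ hs4 hs2 R T hR.le 1 (Or.inl rfl)
  obtain ⟨B₂, hB₂⟩ := unif_bound hΦ hs4 hs2 R T hR.le (-1) (Or.inr rfl)
  set B := max (max B₁ B₂) 0 with hB
  have hB0 : 0 ≤ 4 * B := by have := le_max_right (max B₁ B₂) 0; linarith
  set C₀ := T / 4 * ((∑' k, wt (-(2 * s)) k) * (4 * B) * (T * (2 *
        Real.exp (T / 2 * ((∑' k, wt (-(2 * s)) k) * (4 * B)) * T)))) with hC₀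
  refine ⟨Real.sqrt C₀ + 1, by positivity, ?_⟩
  intro u₀ v₀ hur hum huR hvr hvm hvR t ht
  have hK : ∀ w : ℤ → ℂ, IsRealSeq w → MemHs (1/2) w → hsNorm (1/2) w < R → w ∈ KK R := by
    intro w hw hwm hwR
    refine ⟨hw, fun S => ?_⟩
    refine (hwm.sum_le_tsum S fun k _ => term_nonneg _ _ k).trans ?_
    have := pow_le_pow_left₀ (hsNorm_nonneg _ _) hwR.le 2
    rwa [hsNorm_sq] at this
  obtain ⟨σ, hσ, hσt⟩ : ∃ σ : ℝ, (σ = 1 ∨ σ = -1) ∧ t = σ * |t| := by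
    rcases le_total 0 t with h | h
    · exact ⟨1, Or.inl rfl, by rw [abs_of_nonneg h, one_mul]⟩
    · exact ⟨-1, Or.inr rfl, by rw [abs_of_nonpos h]; ring⟩
  have hbd : ∀ w ∈ KK R, ∀ τ ∈ Set.Icc 0 T, Q s (Φ (σ * τ) w) ≤ B := by
    intro w hw τ hτ
    rcases hσ with rfl | rfl
    · exact (hB₁ w hw τ hτ).trans ((le_max_left _ _).trans (le_max_left _ _))
    · exact (hB₂ w hw τ hτ).trans ((le_max_right _ _).trans (le_max_left _ _))
  have hu := flow_HC hΦ hs2.le hur hum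
  have hv := flow_HC hΦ hs2.le hvr hvm
  have hfin := final_est hs4 (by linarith) hu hv (T := T) hσ (hum.mono hs2.le) (hvm.mono hs2.le)
    (hΦ u₀ hur hum).2.2.2 (hΦ v₀ hvr hvm).2.2.2 hB0 (fun τ hτ => by
      have h1 := (MemHs_add (hu.1 (σ * τ)) (hv.1 (σ * τ))).2
      have h2 := hbd u₀ (hK u₀ hur hum huR) τ hτ
      have h3 := hbd v₀ (hK v₀ hvr hvm hvR) τ hτ
      linarith) |t| ⟨abs_nonneg t, ht⟩
  rw [← hσt, ← hC₀] at hfin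
  have e : (fun k => nonlinPart Φ t u₀ k - nonlinPart Φ t v₀ k) =
      DD u₀ v₀ (fun t => Φ t u₀) (fun t => Φ t v₀) t := by
    funext k; unfold nonlinPart DD; ring
  rw [e, h1s]
  have hC0 : 0 ≤ C₀ := by
    have : 0 ≤ ∑' k, wt (-(2 * s)) k := tsum_nonneg fun k => (wt_pos _ k).le
    positivity
  calc _ ≤ Real.sqrt (C₀ * Q s (fun k => u₀ k - v₀ k)) := Real.sqrt_le_sqrt hfin
    _ = Real.sqrt C₀ * hsNorm s (fun k => u₀ k - v₀ k) := Real.sqrt_mul hC0 _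
    _ ≤ _ := mul_le_mul_of_nonneg_right (by linarith) (hsNorm_nonneg _ _)

end BBM
end
end
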